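/- Let H be a quasi-bialgebra over k and A an H-bimodule algebra. Then the L-R-smash product A ♮ H, namely the vector space A⊗H with multiplication (φ⊗h)(φ'⊗h') = (x¹·φ·z³h'₂y²)(x²h₁z¹·φ'·y³) ⊗ x³h₂z²h'₁y¹ (where x, y, z are three copies of Φ⁻¹), is an associative unital algebra with unit 1_A⊗1_H. -/

import Mathlib

open TensorProduct LinearMap

noncomputable section

variable {k : Type*} [Field k]

section Helpers

variable {M N P Q : Type*}
  [AddCommMonoid M] [AddCommMonoid N] [AddCommMonoid P] [AddCommMonoid Q]
  [Module k M] [Module k N] [Module k P] [Module k Q]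

def aso : (M ⊗[k] N) ⊗[k] P →ₗ[k] M ⊗[k] (N ⊗[k] P) :=
  (TensorProduct.assoc k M N P).toLinearMap

def osa : M ⊗[k] (N ⊗[k] P) →ₗ[k] (M ⊗[k] N) ⊗[k] P :=
  (TensorProduct.assoc k M N P).symm.toLinearMap

def cc : M ⊗[k] N →ₗ[k] N ⊗[k] M := (TensorProduct.comm k M N).toLinearMap

def lc : M ⊗[k] (N ⊗[k] P) →ₗ[k] N ⊗[k] (M ⊗[k] P) :=
  (TensorProduct.leftComm k M N P).toLinearMap

def tt : (M ⊗[k] N) ⊗[k] (P ⊗[k] Q) →ₗ[k] (M ⊗[k] P) ⊗[k] (N ⊗[k] Q) :=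
  (TensorProduct.tensorTensorTensorComm k M N P Q).toLinearMap

end Helpers

section LRCrossed

variable (k)
variable (H U : Type*) [Ring H] [Algebra k H] [AddCommGroup U] [Module k U]

abbrev mH : H ⊗[k] H →ₗ[k] H := LinearMap.mul' k H

def dR : (H ⊗[k] H) ⊗[k] H →ₗ[k] H ⊗[k] H :=
  rTensor H (mH k H) ∘ₗ osa ∘ₗ lTensor H cc ∘ₗ aso

/-- `d ⊗ (g ⊗ i) ↦ (d*g) ⊗ i`. -/
def dL : H ⊗[k] (H ⊗[k] H) →ₗ[k] H ⊗[k] H :=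
  rTensor H (mH k H) ∘ₗ osa

/-- `(g ⊗ i) ⊗ d ↦ g ⊗ (d*i)`. -/
def eR : (H ⊗[k] H) ⊗[k] H →ₗ[k] H ⊗[k] H :=
  lTensor H ((mH k H) ∘ₗ cc) ∘ₗ aso

/-- `d ⊗ (g ⊗ i) ↦ g ⊗ (i*d)`. -/
def eL : H ⊗[k] (H ⊗[k] H) →ₗ[k] H ⊗[k] H :=
  lTensor H ((mH k H) ∘ₗ cc) ∘ₗ lc

/-- `(g ⊗ i) ⊗ (a ⊗ b) ↦ (g*a) ⊗ (b*i)`. -/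
def mulLR : (H ⊗[k] H) ⊗[k] (H ⊗[k] H) →ₗ[k] H ⊗[k] H :=
  TensorProduct.map (mH k H) ((mH k H) ∘ₗ cc) ∘ₗ tt


def w12 : H ⊗[k] (H ⊗[k] H) →ₗ[k] H ⊗[k] H :=
  lTensor H ((mH k H) ∘ₗ cc) ∘ₗ lc ∘ₗ lTensor H cc

def inner12 : (H ⊗[k] H) ⊗[k] (H ⊗[k] H) →ₗ[k] H ⊗[k] H :=
  lTensor H ((mH k H) ∘ₗ cc) ∘ₗ aso ∘ₗ lTensor (H ⊗[k] H) ((mH k H) ∘ₗ cc)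

/-- `(g ⊗ i) ⊗ (b ⊗ (d ⊗ e)) ↦ g * d * e * b * i`. -/
def omegaM : (H ⊗[k] H) ⊗[k] (H ⊗[k] (H ⊗[k] H)) →ₗ[k] H :=
  (mH k H) ∘ₗ
    TensorProduct.map (mH k H) ((mH k H) ∘ₗ rTensor H (mH k H) ∘ₗ cc) ∘ₗ
    tt ∘ₗ lTensor (H ⊗[k] H) (lTensor H cc ∘ₗ lc)

variable {H U}
variable (J : H ⊗[k] U →ₗ[k] U ⊗[k] H) (T : U ⊗[k] H →ₗ[k] U ⊗[k] H)
variable (γ : U ⊗[k] U →ₗ[k] U ⊗[k] (U ⊗[k] H))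
variable (η : U ⊗[k] U →ₗ[k] U ⊗[k] (H ⊗[k] H))

variable (oneU : U)

/-- Axiom (1): `J(h ⊗ 1_U) = 1_U ⊗ h` and `J(1_H ⊗ u) = u ⊗ 1_H`. -/
def LRax1 : Prop :=
  (∀ h : H, J (h ⊗ₜ oneU) = oneU ⊗ₜ h) ∧ (∀ u : U, J ((1 : H) ⊗ₜ u) = u ⊗ₜ (1 : H))

/-- Axiom (2): `T(u ⊗ 1_H) = u ⊗ 1_H` and `T(1_U ⊗ h) = 1_U ⊗ h`. -/
def LRax2 : Prop :=
  (∀ u : U, T (u ⊗ₜ (1 : H)) = u ⊗ₜ (1 : H)) ∧ (∀ h : H, T (oneU ⊗ₜ h) = oneU ⊗ₜ h)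

/-- Axiom (3): `γ(u ⊗ 1_U) = u ⊗ 1_U ⊗ 1_H` and `γ(1_U ⊗ u) = 1_U ⊗ u ⊗ 1_H`. -/
def LRax3 : Prop :=
  (∀ u : U, γ (u ⊗ₜ oneU) = u ⊗ₜ (oneU ⊗ₜ (1 : H))) ∧
  (∀ u : U, γ (oneU ⊗ₜ u) = oneU ⊗ₜ (u ⊗ₜ (1 : H)))

/-- Axiom (4): `η(u ⊗ 1_U) = η(1_U ⊗ u) = u ⊗ 1_H ⊗ 1_H`. -/
def LRax4 : Prop :=
  (∀ u : U, η (u ⊗ₜ oneU) = u ⊗ₜ ((1 : H) ⊗ₜ (1 : H))) ∧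
  (∀ u : U, η (oneU ⊗ₜ u) = u ⊗ₜ ((1 : H) ⊗ₜ (1 : H)))

/-- Axiom (5): `u_J ⊗ (hh')_J = (u_J)_j ⊗ h_j h'_J`. -/
def LRax5 : Prop := ∀ (h h' : H) (u : U),
  J ((h * h') ⊗ₜ u) =
    lTensor U (mH k H) (aso (rTensor H J (osa (h ⊗ₜ (J (h' ⊗ₜ u))))))

/-- Axiom (6): `u_T ⊗ (hh')_T = (u_T)_t ⊗ h_T h'_t`. -/
def LRax6 : Prop := ∀ (u : U) (h h' : H),
  T (u ⊗ₜ (h * h')) =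
    lTensor U ((mH k H) ∘ₗ cc)
      (aso (rTensor H T (osa (lTensor U cc (aso ((T (u ⊗ₜ h)) ⊗ₜ h'))))))

/-- Axiom (7):
`η₁(u_J,u'_j) ⊗ η₂(u_J,u'_j)(h_J)_j ⊗ η₃(u_J,u'_j) = η₁(u,u')_J ⊗ h_J η₂(u,u') ⊗ η₃(u,u')`. -/
def LRax7 : Prop := ∀ (h : H) (u u' : U),
  lTensor U (dR k H)
      (aso (rTensor H η (osa (lTensor U J (aso ((J (h ⊗ₜ u)) ⊗ₜ u'))))))
  = lTensor U (dL k H)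
      (aso (rTensor (H ⊗[k] H) J (osa (h ⊗ₜ (η (u ⊗ₜ u'))))))

/-- Axiom (8):
`η₁(u_t,u'_T) ⊗ η₂(u_t,u'_T) ⊗ (h_T)_t η₃(u_t,u'_T) = η₁(u,u')_T ⊗ η₂(u,u') ⊗ η₃(u,u')h_T`. -/
def LRax8 : Prop := ∀ (u u' : U) (h : H),
  lTensor U (eR k H)
      (aso (rTensor H η (osa (lTensor U cc
        (aso (rTensor U T (osa (lTensor U cc (u ⊗ₜ (T (u' ⊗ₜ h)))))))))))
  = lTensor U (eL k H)
      (aso (rTensor (H ⊗[k] H) T (osa (lTensor U cc (aso ((η (u ⊗ₜ u')) ⊗ₜ h))))))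

/-- Axiom (9). -/
def LRax9 : Prop := ∀ (u u' u'' : U),
  lTensor U (mulLR k H)
      (aso (rTensor (H ⊗[k] H) η (osa (lTensor U (aso (P := H))
        ((lTensor U (rTensor H J ∘ₗ osa ∘ₗ lTensor H cc ∘ₗ aso))
          (aso ((η (u ⊗ₜ u')) ⊗ₜ u'')))))))
  = lTensor U ((mulLR k H) ∘ₗ lTensor (H ⊗[k] H) cc)
      (aso (rTensor (H ⊗[k] H) η (tt (rTensor (U ⊗[k] H) T
        (osa (lTensor U (lc ∘ₗ lTensor U cc) (u ⊗ₜ (η (u' ⊗ₜ u'')))))))))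


def qJ : (U ⊗[k] H) ⊗[k] H →ₗ[k] U ⊗[k] H :=
  lTensor U (mH k H) ∘ₗ aso ∘ₗ rTensor H J ∘ₗ osa ∘ₗ lc ∘ₗ lTensor U cc ∘ₗ aso

/-- Axiom (10). -/
def LRax10 : Prop := ∀ (u u' : U) (h : H),
  lTensor U (lTensor U ((mH k H) ∘ₗ cc))
      (aso (tt (rTensor (U ⊗[k] H) T (osa (lTensor U cc
        (aso (rTensor H γ (osa (u ⊗ₜ (J (h ⊗ₜ u')))))))))))
  = lTensor U (qJ k J)
      (aso (rTensor H γ (osa (lTensor U cc (aso ((T (u ⊗ₜ h)) ⊗ₜ u'))))))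

def psi11 : (U ⊗[k] H) ⊗[k] (H ⊗[k] H) →ₗ[k] U ⊗[k] (H ⊗[k] H) :=
  lTensor U (rTensor H (mH k H) ∘ₗ osa) ∘ₗ aso

def chainX : (U ⊗[k] H) ⊗[k] (U ⊗[k] H) →ₗ[k] U ⊗[k] (H ⊗[k] H) :=
  (lTensor U ((dR k H) ∘ₗ lTensor (H ⊗[k] H) (mH k H))) ∘ₗ aso ∘ₗ
    rTensor (H ⊗[k] H) η ∘ₗ rTensor (H ⊗[k] H) cc ∘ₗ tt ∘ₗ
    lTensor (U ⊗[k] H) cc ∘ₗ rTensor (H ⊗[k] U) J ∘ₗ rTensor (H ⊗[k] U) cc ∘ₗ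
    tt ∘ₗ lTensor (U ⊗[k] H) cc

/-- Axiom (11). -/
def LRax11 : Prop := ∀ (u u' u'' : U),
  lTensor U (psi11 k)
      (aso (tt (rTensor ((U ⊗[k] H) ⊗[k] H) T (tt (rTensor (H ⊗[k] H) γ
        (osa (u ⊗ₜ (η (u' ⊗ₜ u'')))))))))
  = lTensor U (chainX k J η)
      (aso (rTensor (U ⊗[k] H) γ (osa (lTensor U cc
        (aso ((γ (u ⊗ₜ u')) ⊗ₜ u''))))))

def chain12 : (U ⊗[k] H) ⊗[k] (H ⊗[k] H) →ₗ[k] U ⊗[k] (H ⊗[k] H) :=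
  (lTensor U (w12 k H)) ∘ₗ aso ∘ₗ tt ∘ₗ rTensor (H ⊗[k] H) J ∘ₗ
    rTensor (H ⊗[k] H) cc ∘ₗ tt ∘ₗ lTensor (U ⊗[k] H) cc

def big12 : (H ⊗[k] H) ⊗[k] (H ⊗[k] (U ⊗[k] H)) →ₗ[k] U ⊗[k] (H ⊗[k] H) :=
  lTensor U (inner12 k H) ∘ₗ lc ∘ₗ lTensor (H ⊗[k] H) lc

/-- Axiom (12). -/
def LRax12 : Prop := ∀ (u u' u'' : U),
  lTensor U (chain12 k J)
      (aso (rTensor (H ⊗[k] H) γ (osa (lTensor U cc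
        (aso ((η (u ⊗ₜ u')) ⊗ₜ u''))))))
  = lTensor U (big12 k)
      (aso (rTensor (H ⊗[k] (U ⊗[k] H)) η (tt (lTensor (U ⊗[k] H) cc
        (rTensor ((U ⊗[k] H) ⊗[k] U) T (tt (lTensor (U ⊗[k] (U ⊗[k] H)) cc
          (rTensor (U ⊗[k] H) γ (osa (lTensor U lc (u ⊗ₜ (γ (u' ⊗ₜ u'')))))))))))))

def w13 : H ⊗[k] (U ⊗[k] H) →ₗ[k] U ⊗[k] H :=
  lTensor U ((mH k H) ∘ₗ cc) ∘ₗ lc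

def xi2 : H ⊗[k] (U ⊗[k] H) →ₗ[k] U ⊗[k] H :=
  lTensor U (mH k H) ∘ₗ aso ∘ₗ rTensor H J ∘ₗ osa

def xi : H ⊗[k] (U ⊗[k] (U ⊗[k] H)) →ₗ[k] U ⊗[k] (U ⊗[k] H) :=
  lTensor U (xi2 k J) ∘ₗ lc

def rho : (U ⊗[k] H) ⊗[k] U →ₗ[k] (U ⊗[k] (U ⊗[k] H)) ⊗[k] H :=
  rTensor H γ ∘ₗ osa ∘ₗ lTensor U cc ∘ₗ aso

def chainR : ((U ⊗[k] (U ⊗[k] H)) ⊗[k] H) ⊗[k] H →ₗ[k] (U ⊗[k] H) ⊗[k] (U ⊗[k] H) :=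
  tt ∘ₗ lTensor (U ⊗[k] U) cc ∘ₗ
    lTensor (U ⊗[k] U) (rTensor H ((mH k H) ∘ₗ cc) ∘ₗ osa) ∘ₗ tt ∘ₗ
    lTensor (U ⊗[k] H) aso ∘ₗ rTensor ((U ⊗[k] H) ⊗[k] H) T ∘ₗ tt ∘ₗ
    lTensor (U ⊗[k] (U ⊗[k] H)) cc ∘ₗ aso

/-- The composite computing the right-hand side of axiom (13). -/
def rhs13 : ((H ⊗[k] (U ⊗[k] U)) ⊗[k] U) ⊗[k] H →ₗ[k]
    (U ⊗[k] (U ⊗[k] H)) ⊗[k] (U ⊗[k] H) :=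
  osa ∘ₗ lTensor U (chainR k T) ∘ₗ aso ∘ₗ
    rTensor H (lTensor U (rho k γ) ∘ₗ aso ∘ₗ rTensor U ((xi k J) ∘ₗ lTensor H γ))

/-- Axiom (13). -/
def LRax13 : Prop := ∀ (u u' u'' : U) (h h' : H),
  rTensor (U ⊗[k] H) (xi k J)
      (osa (h' ⊗ₜ (lTensor (U ⊗[k] (U ⊗[k] H)) (w13 k)
        (aso (rTensor (U ⊗[k] H) (rTensor H γ) (rTensor (U ⊗[k] H) osa
          (osa (u ⊗ₜ (rTensor (U ⊗[k] H) T (osa (lTensor U cc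
            (aso ((γ (u' ⊗ₜ u'')) ⊗ₜ h)))))))))))))
  = rhs13 k J T γ (((h' ⊗ₜ (u ⊗ₜ u')) ⊗ₜ u'') ⊗ₜ h)

/-- The L-R-crossed product multiplication, as a linear map. -/
def lrM : (U ⊗[k] H) ⊗[k] (U ⊗[k] H) →ₗ[k] U ⊗[k] H :=
  lTensor U (omegaM k H) ∘ₗ aso ∘ₗ rTensor (H ⊗[k] (H ⊗[k] H)) η ∘ₗ tt ∘ₗ
    lTensor (U ⊗[k] H) aso ∘ₗ rTensor ((U ⊗[k] H) ⊗[k] H) T ∘ₗ tt ∘ₗ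
    lTensor (U ⊗[k] (U ⊗[k] H)) cc ∘ₗ
    rTensor (H ⊗[k] H) (lTensor U J ∘ₗ lTensor U cc ∘ₗ aso) ∘ₗ tt ∘ₗ
    rTensor (H ⊗[k] H) (osa ∘ₗ γ) ∘ₗ tt

/-- The L-R-crossed product multiplication of two elements of `U ⊗ H`. -/
def lrMul (x y : U ⊗[k] H) : U ⊗[k] H := lrM k J T γ η (x ⊗ₜ y)

end LRCrossed


section QuasiBialgebra

variable {k : Type*} [Field k]
variable {H : Type*} [Ring H] [Algebra k H]
variable {A : Type*} [AddCommGroup A] [Module k A]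

/-- The axioms making `(H, Δ, ε, Φ)` a quasi-bialgebra, where `Φinv` is a two-sided
inverse of the associator `Φ ∈ H ⊗ H ⊗ H`. -/
structure IsQuasiBialgebra (Δ : H →ₐ[k] H ⊗[k] H) (ε : H →ₐ[k] k)
    (Φ Φinv : (H ⊗[k] H) ⊗[k] H) : Prop where
  coassoc : ∀ h : H,
    osa (lTensor H Δ.toLinearMap (Δ.toLinearMap h)) =
      Φ * (rTensor H Δ.toLinearMap (Δ.toLinearMap h)) * Φinv
  pentagon :
    (osa (lTensor (H ⊗[k] H) Δ.toLinearMap Φ)) *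
        (rTensor H (rTensor H Δ.toLinearMap) Φ) =
      (rTensor H (rTensor H (TensorProduct.mk k H H (1 : H))) Φ) *
        (rTensor H ((osa : H ⊗[k] (H ⊗[k] H) →ₗ[k] (H ⊗[k] H) ⊗[k] H) ∘ₗ
          lTensor H Δ.toLinearMap) Φ) *
        (((TensorProduct.mk k ((H ⊗[k] H) ⊗[k] H) H).flip (1 : H)) Φ)
  counit_left : ∀ h : H, TensorProduct.lid k H (rTensor H ε.toLinearMap (Δ.toLinearMap h)) = h
  counit_right : ∀ h : H, TensorProduct.rid k H (lTensor H ε.toLinearMap (Δ.toLinearMap h)) = h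
  counit_phi :
    rTensor H (TensorProduct.rid k H).toLinearMap (rTensor H (lTensor H ε.toLinearMap) Φ) =
      (1 : H) ⊗ₜ (1 : H)
  phi_inv : Φ * Φinv = 1
  inv_phi : Φinv * Φ = 1

variable (actL : H ⊗[k] A →ₗ[k] A) (actR : A ⊗[k] H →ₗ[k] A)

/-- `X ⊗ (φ ⊗ x) ↦ (X · φ) · x`. -/
def biact : H ⊗[k] (A ⊗[k] H) →ₗ[k] A := actR ∘ₗ rTensor H actL ∘ₗ osa

/-- `(X ⊗ y) ⊗ φ ↦ (X · φ) · y`. -/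
def triAct : (H ⊗[k] H) ⊗[k] A →ₗ[k] A :=
  actR ∘ₗ rTensor H actL ∘ₗ osa ∘ₗ lTensor H cc ∘ₗ aso

/-- Zipping two triples: `((x₁⊗x₂)⊗x₃) ⊗ ((y₁⊗y₂)⊗y₃) ↦ ((x₁⊗y₁)⊗(x₂⊗y₂))⊗(x₃⊗y₃)`. -/
def zip3 {M N : Type*} [AddCommMonoid M] [AddCommMonoid N] [Module k M] [Module k N] :
    ((M ⊗[k] M) ⊗[k] M) ⊗[k] ((N ⊗[k] N) ⊗[k] N) →ₗ[k]
      ((M ⊗[k] N) ⊗[k] (M ⊗[k] N)) ⊗[k] (M ⊗[k] N) :=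
  rTensor (M ⊗[k] N) tt ∘ₗ tt

variable (mulA : A ⊗[k] A →ₗ[k] A)

/-- `Φ ⊗ (Φ⁻¹ ⊗ ((φ⊗φ')⊗φ'')) ↦ (X¹·φ·x¹)((X²·φ'·x²)(X³·φ''·x³))`. -/
def quasiAct : ((H ⊗[k] H) ⊗[k] H) ⊗[k]
    (((H ⊗[k] H) ⊗[k] H) ⊗[k] ((A ⊗[k] A) ⊗[k] A)) →ₗ[k] A :=
  mulA ∘ₗ lTensor A mulA ∘ₗ aso ∘ₗ
    TensorProduct.map (TensorProduct.map (biact actL actR) (biact actL actR))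
      (biact actL actR) ∘ₗ
    zip3 ∘ₗ lTensor ((H ⊗[k] H) ⊗[k] H) (zip3 ∘ₗ cc)

/-- The `H`-bimodule algebra axioms for `A` over the quasi-bialgebra `(H, Δ, ε, Φ)`. -/
structure IsBimoduleAlgebra (Δ : H →ₐ[k] H ⊗[k] H) (ε : H →ₐ[k] k)
    (Φ Φinv : (H ⊗[k] H) ⊗[k] H) (oneA : A) : Prop where
  actL_actL : ∀ (h h' : H) (φ : A), actL (h ⊗ₜ actL (h' ⊗ₜ φ)) = actL ((h * h') ⊗ₜ φ)
  one_actL : ∀ φ : A, actL ((1 : H) ⊗ₜ φ) = φ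
  actR_actR : ∀ (φ : A) (h h' : H), actR (actR (φ ⊗ₜ h) ⊗ₜ h') = actR (φ ⊗ₜ (h * h'))
  actR_one : ∀ φ : A, actR (φ ⊗ₜ (1 : H)) = φ
  actL_actR : ∀ (h : H) (φ : A) (h' : H),
    actR (actL (h ⊗ₜ φ) ⊗ₜ h') = actL (h ⊗ₜ actR (φ ⊗ₜ h'))
  actL_mulA : ∀ (h : H) (φ φ' : A),
    actL (h ⊗ₜ mulA (φ ⊗ₜ φ')) =
      mulA (TensorProduct.map actL actL (tt ((Δ.toLinearMap h) ⊗ₜ (φ ⊗ₜ φ'))))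
  actR_mulA : ∀ (h : H) (φ φ' : A),
    actR (mulA (φ ⊗ₜ φ') ⊗ₜ h) =
      mulA (TensorProduct.map actR actR (tt ((φ ⊗ₜ φ') ⊗ₜ (Δ.toLinearMap h))))
  actL_one : ∀ h : H, actL (h ⊗ₜ oneA) = ε h • oneA
  one_actR : ∀ h : H, actR (oneA ⊗ₜ h) = ε h • oneA
  mulA_one : ∀ φ : A, mulA (φ ⊗ₜ oneA) = φ
  one_mulA : ∀ φ : A, mulA (oneA ⊗ₜ φ) = φ
  quasi_assoc : ∀ φ φ' φ'' : A,
    mulA (mulA (φ ⊗ₜ φ') ⊗ₜ φ'') =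
      quasiAct actL actR mulA (Φ ⊗ₜ (Φinv ⊗ₜ ((φ ⊗ₜ φ') ⊗ₜ φ'')))

variable (Δ : H →ₐ[k] H ⊗[k] H) (Φinv : (H ⊗[k] H) ⊗[k] H)

/-- `J(h ⊗ φ) = h₁·φ ⊗ h₂`. -/
def smashJ : H ⊗[k] A →ₗ[k] A ⊗[k] H :=
  rTensor H actL ∘ₗ osa ∘ₗ lTensor H cc ∘ₗ aso ∘ₗ rTensor A Δ.toLinearMap

/-- `T(φ ⊗ h) = φ·h₂ ⊗ h₁`. -/
def smashT : A ⊗[k] H →ₗ[k] A ⊗[k] H :=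
  rTensor H actR ∘ₗ osa ∘ₗ lTensor A cc ∘ₗ lTensor A Δ.toLinearMap

/-- `((z¹⊗z²)⊗z³) ⊗ (φ⊗φ') ↦ (φ·z³) ⊗ ((z¹·φ') ⊗ z²)`. -/
def smashΓ : ((H ⊗[k] H) ⊗[k] H) ⊗[k] (A ⊗[k] A) →ₗ[k] A ⊗[k] (A ⊗[k] H) :=
  lc ∘ₗ
    lTensor A (cc ∘ₗ lTensor H (actR ∘ₗ cc) ∘ₗ aso) ∘ₗ
    rTensor ((H ⊗[k] H) ⊗[k] A) actL ∘ₗ tt ∘ₗ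
    lTensor (H ⊗[k] (H ⊗[k] H)) cc ∘ₗ rTensor (A ⊗[k] A) aso

/-- `γ(φ ⊗ φ') = φ·z³ ⊗ z¹·φ' ⊗ z²` with `z = Φ⁻¹`. -/
def smashγ : A ⊗[k] A →ₗ[k] A ⊗[k] (A ⊗[k] H) :=
  smashΓ actL actR ∘ₗ TensorProduct.mk k ((H ⊗[k] H) ⊗[k] H) (A ⊗[k] A) Φinv

/-- Reordering and zipping two copies of `Φ⁻¹`:
`((x¹⊗x²)⊗x³) ⊗ ((y¹⊗y²)⊗y³) ↦ ((x¹⊗y²)⊗(x²⊗y³))⊗(x³⊗y¹)`. -/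
def smashΞ : ((H ⊗[k] H) ⊗[k] H) ⊗[k] ((H ⊗[k] H) ⊗[k] H) →ₗ[k]
    ((H ⊗[k] H) ⊗[k] (H ⊗[k] H)) ⊗[k] (H ⊗[k] H) :=
  rTensor (H ⊗[k] H) tt ∘ₗ tt ∘ₗ lTensor ((H ⊗[k] H) ⊗[k] H) (cc ∘ₗ aso)

/-- `((x²⊗y³)⊗(x³⊗y¹)) ⊗ φ' ↦ (x²·φ'·y³) ⊗ (x³⊗y¹)`. -/
def smashSec : (((H ⊗[k] H) ⊗[k] (H ⊗[k] H)) ⊗[k] A) →ₗ[k] A ⊗[k] (H ⊗[k] H) :=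
  rTensor (H ⊗[k] H) (triAct actL actR) ∘ₗ osa ∘ₗ lTensor (H ⊗[k] H) cc ∘ₗ aso

/-- `(Φ⁻¹ ⊗ Φ⁻¹) ⊗ (φ⊗φ') ↦ (x¹·φ·y²)(x²·φ'·y³) ⊗ (x³ ⊗ y¹)`. -/
def smashΛ : (((H ⊗[k] H) ⊗[k] H) ⊗[k] ((H ⊗[k] H) ⊗[k] H)) ⊗[k] (A ⊗[k] A) →ₗ[k]
    A ⊗[k] (H ⊗[k] H) :=
  rTensor (H ⊗[k] H) mulA ∘ₗ osa ∘ₗ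
    TensorProduct.map (triAct actL actR) (smashSec actL actR) ∘ₗ tt ∘ₗ
    rTensor (A ⊗[k] A) aso ∘ₗ rTensor (A ⊗[k] A) smashΞ

/-- `η(φ ⊗ φ') = (x¹·φ·y²)(x²·φ'·y³) ⊗ x³ ⊗ y¹` with `x, y` copies of `Φ⁻¹`. -/
def smashη : A ⊗[k] A →ₗ[k] A ⊗[k] (H ⊗[k] H) :=
  smashΛ actL actR mulA ∘ₗ
    TensorProduct.mk k (((H ⊗[k] H) ⊗[k] H) ⊗[k] ((H ⊗[k] H) ⊗[k] H)) (A ⊗[k] A)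
      (Φinv ⊗ₜ Φinv)

end QuasiBialgebra


section SmashRHS

variable {k : Type*} [Field k]
variable {H : Type*} [Ring H] [Algebra k H]
variable {A : Type*} [AddCommGroup A] [Module k A]
variable (actL : H ⊗[k] A →ₗ[k] A) (actR : A ⊗[k] H →ₗ[k] A)
variable (mulA : A ⊗[k] A →ₗ[k] A)
variable (Δ : H →ₐ[k] H ⊗[k] H) (Φinv : (H ⊗[k] H) ⊗[k] H)

/-- `h'₂ ⊗ ((z³⊗y²) ⊗ G₂) ↦ (z³ ⊗ (h'₂ ⊗ y²)) ⊗ G₂`. -/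
def ins1 : H ⊗[k] ((H ⊗[k] H) ⊗[k] (H ⊗[k] H)) →ₗ[k]
    (H ⊗[k] (H ⊗[k] H)) ⊗[k] (H ⊗[k] H) :=
  rTensor (H ⊗[k] H) lc ∘ₗ osa

/-- `h₁ ⊗ (K₁ ⊗ (z¹⊗y³)) ↦ K₁ ⊗ ((h₁⊗z¹) ⊗ y³)`. -/
def ins2 : H ⊗[k] ((H ⊗[k] (H ⊗[k] H)) ⊗[k] (H ⊗[k] H)) →ₗ[k]
    (H ⊗[k] (H ⊗[k] H)) ⊗[k] ((H ⊗[k] H) ⊗[k] H) :=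
  lTensor (H ⊗[k] (H ⊗[k] H)) osa ∘ₗ lc

/-- `(x¹ ⊗ (z³ ⊗ (h'₂ ⊗ y²))) ⊗ φ ↦ x¹·φ·(z³h'₂y²)`. -/
def smashL : (H ⊗[k] (H ⊗[k] (H ⊗[k] H))) ⊗[k] A →ₗ[k] A :=
  triAct actL actR ∘ₗ
    rTensor A (lTensor H ((LinearMap.mul' k H) ∘ₗ lTensor H (LinearMap.mul' k H)))

/-- `(x² ⊗ ((h₁ ⊗ z¹) ⊗ y³)) ⊗ φ' ↦ (x²h₁z¹)·φ'·y³`. -/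
def smashR : (H ⊗[k] ((H ⊗[k] H) ⊗[k] H)) ⊗[k] A →ₗ[k] A :=
  triAct actL actR ∘ₗ
    rTensor A (rTensor H ((LinearMap.mul' k H) ∘ₗ lTensor H (LinearMap.mul' k H)) ∘ₗ osa)

/-- `x³ ⊗ (h₂ ⊗ (z² ⊗ (h'₁ ⊗ y¹))) ↦ x³h₂z²h'₁y¹`. -/
def smashF : H ⊗[k] (H ⊗[k] (H ⊗[k] (H ⊗[k] H))) →ₗ[k] H :=
  (LinearMap.mul' k H) ∘ₗ lTensor H ((LinearMap.mul' k H) ∘ₗ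
    lTensor H ((LinearMap.mul' k H) ∘ₗ lTensor H (LinearMap.mul' k H)))

/-- The right-hand side of the L-R-smash product multiplication formula:
`(φ⊗h)(φ'⊗h') = (x¹·φ·z³h'₂y²)(x²h₁z¹·φ'·y³) ⊗ x³h₂z²h'₁y¹`,
where `x`, `y`, `z` are three copies of `Φ⁻¹`. -/
def smashRHS (φ φ' : A) (h h' : H) : A ⊗[k] H :=
  let G : ((H ⊗[k] H) ⊗[k] (H ⊗[k] H)) ⊗[k] (H ⊗[k] H) :=
    zip3 (((osa ∘ₗ cc) Φinv) ⊗ₜ ((cc ∘ₗ (aso : (H ⊗[k] H) ⊗[k] H →ₗ[k] H ⊗[k] (H ⊗[k] H))) Φinv))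
  let s2 : ((H ⊗[k] (H ⊗[k] H)) ⊗[k] (H ⊗[k] H)) ⊗[k] (H ⊗[k] (H ⊗[k] H)) :=
    TensorProduct.map ins1 lc (tt ((cc (Δ.toLinearMap h')) ⊗ₜ G))
  let s4 : ((H ⊗[k] (H ⊗[k] H)) ⊗[k] ((H ⊗[k] H) ⊗[k] H)) ⊗[k] (H ⊗[k] (H ⊗[k] (H ⊗[k] H))) :=
    TensorProduct.map ins2 LinearMap.id (tt ((Δ.toLinearMap h) ⊗ₜ s2))
  let s5 : ((H ⊗[k] (H ⊗[k] (H ⊗[k] H))) ⊗[k] (H ⊗[k] ((H ⊗[k] H) ⊗[k] H))) ⊗[k]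
      (H ⊗[k] (H ⊗[k] (H ⊗[k] (H ⊗[k] H)))) :=
    rTensor (H ⊗[k] (H ⊗[k] (H ⊗[k] (H ⊗[k] H)))) tt (tt (Φinv ⊗ₜ s4))
  let s9 : (H ⊗[k] (H ⊗[k] (H ⊗[k] (H ⊗[k] H)))) ⊗[k] (A ⊗[k] A) :=
    lTensor (H ⊗[k] (H ⊗[k] (H ⊗[k] (H ⊗[k] H))))
      (TensorProduct.map (smashL actL actR) (smashR actL actR) ∘ₗ tt)
      (aso (rTensor (A ⊗[k] A) cc (s5 ⊗ₜ (φ ⊗ₜ φ'))))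
  cc (TensorProduct.map smashF mulA s9)

end SmashRHS

section TensorLegs

variable {k : Type*} [Field k]

section Evaluation

variable {M N P Q : Type*}
  [AddCommMonoid M] [AddCommMonoid N] [AddCommMonoid P] [AddCommMonoid Q]
  [Module k M] [Module k N] [Module k P] [Module k Q]

@[simp] theorem aso_tmul (m : M) (n : N) (p : P) :
    aso (k := k) ((m ⊗ₜ n) ⊗ₜ p) = m ⊗ₜ (n ⊗ₜ p) := rfl

@[simp] theorem osa_tmul (m : M) (n : N) (p : P) :
    osa (k := k) (m ⊗ₜ (n ⊗ₜ p)) = (m ⊗ₜ n) ⊗ₜ p := rfl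

@[simp] theorem cc_tmul (m : M) (n : N) : cc (k := k) (m ⊗ₜ n) = n ⊗ₜ m := rfl

@[simp] theorem lc_tmul (m : M) (n : N) (p : P) :
    lc (k := k) (m ⊗ₜ (n ⊗ₜ p)) = n ⊗ₜ (m ⊗ₜ p) := rfl

@[simp] theorem tt_tmul (m : M) (n : N) (p : P) (q : Q) :
    tt (k := k) ((m ⊗ₜ n) ⊗ₜ (p ⊗ₜ q)) = (m ⊗ₜ p) ⊗ₜ (n ⊗ₜ q) := rfl

theorem tensor_induction₃ {p : (M ⊗[k] N) ⊗[k] P → Prop} (t : (M ⊗[k] N) ⊗[k] P)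
    (zero : p 0) (tmul : ∀ x y z, p ((x ⊗ₜ y) ⊗ₜ z))
    (add : ∀ s t, p s → p t → p (s + t)) : p t := by
  induction t using TensorProduct.induction_on with
  | zero => exact zero
  | add s t hs ht => exact add s t hs ht
  | tmul u z =>
    induction u using TensorProduct.induction_on with
    | zero => simpa using zero
    | add s t hs ht => simpa only [add_tmul] using add _ _ hs ht
    | tmul x y => exact tmul x y z

theorem tensor_induction_right₃ {p : M ⊗[k] (N ⊗[k] P) → Prop} (t : M ⊗[k] (N ⊗[k] P))
    (zero : p 0) (tmul : ∀ x y z, p (x ⊗ₜ (y ⊗ₜ z)))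
    (add : ∀ s t, p s → p t → p (s + t)) : p t := by
  induction t using TensorProduct.induction_on with
  | zero => exact zero
  | add s t hs ht => exact add s t hs ht
  | tmul x w =>
    induction w using TensorProduct.induction_on with
    | zero => simpa using zero
    | add s t hs ht => simpa only [tmul_add] using add _ _ hs ht
    | tmul y z => exact tmul x y z

end Evaluation

variable {B : Type*} [Ring B] [Algebra k B]

section Convolve

variable {M N : Type*} [AddCommMonoid M] [Module k M] [AddCommMonoid N] [Module k N]

/-- `m ⊗ n ↦ f m * g n`. -/
def tensorMul (f : M →ₗ[k] B) (g : N →ₗ[k] B) : M ⊗[k] N →ₗ[k] B :=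
  LinearMap.mul' k B ∘ₗ TensorProduct.map f g

@[simp] theorem tensorMul_tmul (f : M →ₗ[k] B) (g : N →ₗ[k] B) (m : M) (n : N) :
    tensorMul f g (m ⊗ₜ n) = f m * g n := by
  simp [tensorMul]

theorem commute_tensorMul {f : M →ₗ[k] B} {g : N →ₗ[k] B} {b : B}
    (hf : ∀ m, Commute b (f m)) (hg : ∀ n, Commute b (g n)) (t : M ⊗[k] N) :
    Commute b (tensorMul f g t) := by
  induction t using TensorProduct.induction_on with
  | zero => simp
  | tmul m n => simpa using (hf m).mul_right (hg n)
  | add s t hs ht => simpa using hs.add_right ht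

end Convolve

theorem tensorMul_mul {R S : Type*} [Ring R] [Algebra k R] [Ring S] [Algebra k S]
    {f : R →ₗ[k] B} {g : S →ₗ[k] B}
    (hf : ∀ x y, f (x * y) = f x * f y) (hg : ∀ x y, g (x * y) = g x * g y)
    (hfg : ∀ x y, Commute (f x) (g y)) (s t : R ⊗[k] S) :
    tensorMul f g (s * t) = tensorMul f g s * tensorMul f g t := by
  induction s using TensorProduct.induction_on with
  | zero => simp
  | add s s' hs hs' => simp only [add_mul, map_add, hs, hs']
  | tmul x y =>
    induction t using TensorProduct.induction_on with
    | zero => simp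
    | add s s' hs hs' => simp only [mul_add, map_add, hs, hs']
    | tmul x' y' =>
      simp only [Algebra.TensorProduct.tmul_mul_tmul, tensorMul_tmul, hf, hg]
      exact (hfg x' y).mul_mul_mul_comm _ _

variable {H : Type*} [Ring H] [Algebra k H]

/-- `x ⊗ y ↦ f x * g y`. -/
def leg₂ (f g : H →ₐ[k] B) : H ⊗[k] H →ₗ[k] B :=
  tensorMul f.toLinearMap g.toLinearMap

/-- `(x ⊗ y) ⊗ z ↦ f x * g y * h z`. -/
def leg₃ (f g h : H →ₐ[k] B) : (H ⊗[k] H) ⊗[k] H →ₗ[k] B :=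
  tensorMul (leg₂ f g) h.toLinearMap

/-- `((x ⊗ y) ⊗ z) ⊗ w ↦ f x * g y * h z * p w`. -/
def leg₄ (f g h p : H →ₐ[k] B) : ((H ⊗[k] H) ⊗[k] H) ⊗[k] H →ₗ[k] B :=
  tensorMul (leg₃ f g h) p.toLinearMap

@[simp] theorem leg₂_tmul (f g : H →ₐ[k] B) (x y : H) : leg₂ f g (x ⊗ₜ y) = f x * g y := by
  simp [leg₂]

@[simp] theorem leg₃_tmul (f g h : H →ₐ[k] B) (t : H ⊗[k] H) (z : H) :
    leg₃ f g h (t ⊗ₜ z) = leg₂ f g t * h z := by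
  simp [leg₃]

@[simp] theorem leg₄_tmul (f g h p : H →ₐ[k] B) (t : (H ⊗[k] H) ⊗[k] H) (z : H) :
    leg₄ f g h p (t ⊗ₜ z) = leg₃ f g h t * p z := by
  simp [leg₄]

/-- The images of `f` and `g` commute elementwise. -/
def ImagesCommute (f g : H →ₐ[k] B) : Prop := ∀ x y, Commute (f x) (g y)

theorem commute_leg₂ {b : B} {f g : H →ₐ[k] B} (hf : ∀ x, Commute b (f x))
    (hg : ∀ x, Commute b (g x)) (t : H ⊗[k] H) : Commute b (leg₂ f g t) :=
  commute_tensorMul hf hg t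

theorem commute_leg₃ {b : B} {f g h : H →ₐ[k] B} (hf : ∀ x, Commute b (f x))
    (hg : ∀ x, Commute b (g x)) (hh : ∀ x, Commute b (h x)) (t : (H ⊗[k] H) ⊗[k] H) :
    Commute b (leg₃ f g h t) :=
  commute_tensorMul (commute_leg₂ hf hg) hh t

theorem leg₂_mul {f g : H →ₐ[k] B} (hfg : ImagesCommute f g) (s t : H ⊗[k] H) :
    leg₂ f g (s * t) = leg₂ f g s * leg₂ f g t :=
  tensorMul_mul (by simp) (by simp) (fun x y => hfg x y) s t

theorem leg₃_mul {f g h : H →ₐ[k] B} (hfg : ImagesCommute f g) (hfh : ImagesCommute f h)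
    (hgh : ImagesCommute g h) (s t : (H ⊗[k] H) ⊗[k] H) :
    leg₃ f g h (s * t) = leg₃ f g h s * leg₃ f g h t :=
  tensorMul_mul (leg₂_mul hfg) (by simp)
    (fun x y => (commute_leg₂ (fun z => (hfh z y).symm) (fun z => (hgh z y).symm) x).symm) s t

theorem leg₄_mul {f g h p : H →ₐ[k] B} (hfg : ImagesCommute f g) (hfh : ImagesCommute f h)
    (hfp : ImagesCommute f p) (hgh : ImagesCommute g h) (hgp : ImagesCommute g p)
    (hhp : ImagesCommute h p) (s t : ((H ⊗[k] H) ⊗[k] H) ⊗[k] H) :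
    leg₄ f g h p (s * t) = leg₄ f g h p s * leg₄ f g h p t :=
  tensorMul_mul (leg₃_mul hfg hfh hgh) (by simp)
    (fun x y => (commute_leg₃ (fun z => (hfp z y).symm) (fun z => (hgp z y).symm)
      (fun z => (hhp z y).symm) x).symm) s t

theorem leg₂_one (f g : H →ₐ[k] B) : leg₂ f g 1 = 1 := by
  simp [Algebra.TensorProduct.one_def]

theorem leg₃_one (f g h : H →ₐ[k] B) : leg₃ f g h 1 = 1 := by
  simp [Algebra.TensorProduct.one_def]

theorem map_leg₂ {C : Type*} [Ring C] [Algebra k C] (θ : B →ₐ[k] C) (f g : H →ₐ[k] B)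
    (t : H ⊗[k] H) : θ (leg₂ f g t) = leg₂ (θ.comp f) (θ.comp g) t := by
  induction t using TensorProduct.induction_on with
  | zero => simp
  | tmul x y => simp
  | add s t hs ht => simp only [map_add, hs, ht]

theorem map_leg₃ {C : Type*} [Ring C] [Algebra k C] (θ : B →ₐ[k] C) (f g h : H →ₐ[k] B)
    (t : (H ⊗[k] H) ⊗[k] H) :
    θ (leg₃ f g h t) = leg₃ (θ.comp f) (θ.comp g) (θ.comp h) t := by
  induction t using TensorProduct.induction_on with
  | zero => simp
  | tmul x y => simp [map_leg₂]
  | add s t hs ht => simp only [map_add, hs, ht]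

/-- `x ↦ f x₁ * g x₂`. -/
def coprodLeg (Δ : H →ₐ[k] H ⊗[k] H) (f g : H →ₐ[k] B) (hfg : ImagesCommute f g) :
    H →ₐ[k] B :=
  (Algebra.TensorProduct.lift f g hfg).comp Δ

theorem coprodLeg_apply (Δ : H →ₐ[k] H ⊗[k] H) {f g : H →ₐ[k] B} (hfg : ImagesCommute f g)
    (x : H) : coprodLeg Δ f g hfg x = leg₂ f g (Δ x) := by
  rw [coprodLeg, AlgHom.comp_apply]
  generalize Δ x = t
  induction t using TensorProduct.induction_on with
  | zero => simp
  | tmul x y => exact (Algebra.TensorProduct.lift_tmul f g hfg x y).trans (leg₂_tmul f g x y).symm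
  | add s t hs ht => simp only [map_add, hs, ht]

namespace ImagesCommute

theorem symm {f g : H →ₐ[k] B} (h : ImagesCommute f g) : ImagesCommute g f :=
  fun x y => (h y x).symm

theorem coprodLeg_right {Δ : H →ₐ[k] H ⊗[k] H} {f g p : H →ₐ[k] B}
    (hpf : ImagesCommute p f) (hpg : ImagesCommute p g) (hfg : ImagesCommute f g) :
    ImagesCommute p (coprodLeg Δ f g hfg) := fun x y => by
  rw [coprodLeg_apply]
  exact commute_leg₂ (hpf x) (hpg x) _

theorem coprodLeg_left {Δ : H →ₐ[k] H ⊗[k] H} {f g p : H →ₐ[k] B}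
    (hfp : ImagesCommute f p) (hgp : ImagesCommute g p) (hfg : ImagesCommute f g) :
    ImagesCommute (coprodLeg Δ f g hfg) p :=
  (coprodLeg_right hfp.symm hgp.symm hfg).symm

end ImagesCommute

section Coproduct

variable {Δ : H →ₐ[k] H ⊗[k] H} {f g h p : H →ₐ[k] B}

theorem leg₂_coprodLeg_left (hfg : ImagesCommute f g) (t : H ⊗[k] H) :
    leg₂ (coprodLeg Δ f g hfg) h t = leg₃ f g h (rTensor H Δ.toLinearMap t) := by
  induction t using TensorProduct.induction_on with
  | zero => simp
  | tmul x y => simp [coprodLeg_apply]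
  | add s t hs ht => simp only [map_add, hs, ht]

theorem leg₂_coprodLeg_right (hgh : ImagesCommute g h) (t : H ⊗[k] H) :
    leg₂ f (coprodLeg Δ g h hgh) t = leg₃ f g h (osa (lTensor H Δ.toLinearMap t)) := by
  induction t using TensorProduct.induction_on with
  | zero => simp
  | add s t hs ht => simp only [map_add, hs, ht]
  | tmul x y =>
    simp only [leg₂_tmul, coprodLeg_apply, lTensor_tmul, AlgHom.toLinearMap_apply]
    induction Δ y using TensorProduct.induction_on with
    | zero => simp
    | tmul x y => simp [mul_assoc]
    | add s t hs ht => simp only [map_add, tmul_add, mul_add, hs, ht]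

theorem leg₃_coprodLeg_left (hfg : ImagesCommute f g) (t : (H ⊗[k] H) ⊗[k] H) :
    leg₃ (coprodLeg Δ f g hfg) h p t =
      leg₄ f g h p (rTensor H (rTensor H Δ.toLinearMap) t) := by
  induction t using TensorProduct.induction_on with
  | zero => simp
  | tmul x y => simp [leg₂_coprodLeg_left]
  | add s t hs ht => simp only [map_add, hs, ht]

theorem leg₃_coprodLeg_mid (hgh : ImagesCommute g h) (t : (H ⊗[k] H) ⊗[k] H) :
    leg₃ f (coprodLeg Δ g h hgh) p t =
      leg₄ f g h p (rTensor H ((osa : H ⊗[k] (H ⊗[k] H) →ₗ[k] (H ⊗[k] H) ⊗[k] H) ∘ₗ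
        lTensor H Δ.toLinearMap) t) := by
  induction t using TensorProduct.induction_on with
  | zero => simp
  | tmul x y => simp [leg₂_coprodLeg_right]
  | add s t hs ht => simp only [map_add, hs, ht]

theorem leg₃_coprodLeg_right (hhp : ImagesCommute h p) (t : (H ⊗[k] H) ⊗[k] H) :
    leg₃ f g (coprodLeg Δ h p hhp) t =
      leg₄ f g h p (osa (lTensor (H ⊗[k] H) Δ.toLinearMap t)) := by
  induction t using TensorProduct.induction_on with
  | zero => simp
  | add s t hs ht => simp only [map_add, hs, ht]
  | tmul x y =>
    simp only [leg₃_tmul, coprodLeg_apply, lTensor_tmul, AlgHom.toLinearMap_apply]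
    induction Δ y using TensorProduct.induction_on with
    | zero => simp
    | tmul x y => simp [mul_assoc]
    | add s t hs ht => simp only [map_add, tmul_add, mul_add, hs, ht]

theorem leg₄_one_tmul (t : (H ⊗[k] H) ⊗[k] H) :
    leg₄ f g h p (rTensor H (rTensor H (TensorProduct.mk k H H (1 : H))) t) =
      leg₃ g h p t := by
  induction t using tensor_induction₃ with
  | zero => simp
  | tmul x y z => simp
  | add s t hs ht => simp only [map_add, hs, ht]

end Coproduct

end TensorLegs

section QuasiBialgebraLegs

variable {k : Type*} [Field k] {H : Type*} [Ring H] [Algebra k H]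
  {B : Type*} [Ring B] [Algebra k B]
  {Δ : H →ₐ[k] H ⊗[k] H} {ε : H →ₐ[k] k} {Φ Φinv : (H ⊗[k] H) ⊗[k] H}
  {f g h p : H →ₐ[k] B}

/-- The counit, viewed as a homomorphism to `B`. -/
def counitLeg (B : Type*) [Ring B] [Algebra k B] (ε : H →ₐ[k] k) : H →ₐ[k] B :=
  (Algebra.ofId k B).comp ε

@[simp] theorem counitLeg_apply (x : H) : counitLeg B ε x = algebraMap k B (ε x) := rfl

theorem ImagesCommute.counitLeg_left (f : H →ₐ[k] B) : ImagesCommute (counitLeg B ε) f :=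
  fun _ _ => Algebra.commutes _ _

theorem ImagesCommute.counitLeg_right (f : H →ₐ[k] B) : ImagesCommute f (counitLeg B ε) :=
  (ImagesCommute.counitLeg_left f).symm

namespace IsQuasiBialgebra

variable (hqb : IsQuasiBialgebra Δ ε Φ Φinv)

include hqb

theorem leg₃_phi_mul (hfg : ImagesCommute f g) (hfh : ImagesCommute f h)
    (hgh : ImagesCommute g h) : leg₃ f g h Φ * leg₃ f g h Φinv = 1 := by
  rw [← leg₃_mul hfg hfh hgh, hqb.phi_inv, leg₃_one]

theorem leg₃_inv_mul (hfg : ImagesCommute f g) (hfh : ImagesCommute f h)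
    (hgh : ImagesCommute g h) : leg₃ f g h Φinv * leg₃ f g h Φ = 1 := by
  rw [← leg₃_mul hfg hfh hgh, hqb.inv_phi, leg₃_one]

/-- Quasi-coassociativity, in the form `Φ⁻¹ (id ⊗ Δ)Δ = (Δ ⊗ id)Δ Φ⁻¹`. -/
theorem leg₃_coassoc (hfg : ImagesCommute f g) (hfh : ImagesCommute f h)
    (hgh : ImagesCommute g h) (x : H) :
    leg₃ f g h Φinv * leg₂ f (coprodLeg Δ g h hgh) (Δ x) =
      leg₂ (coprodLeg Δ f g hfg) h (Δ x) * leg₃ f g h Φinv := by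
  rw [leg₂_coprodLeg_left, leg₂_coprodLeg_right, ← leg₃_mul hfg hfh hgh,
    ← leg₃_mul hfg hfh hgh]
  have := hqb.coassoc x
  rw [AlgHom.toLinearMap_apply] at this
  rw [this, mul_assoc, ← mul_assoc, hqb.inv_phi, one_mul]

/-- The pentagon identity for `Φ⁻¹`. -/
theorem leg₃_pentagon (hfg : ImagesCommute f g) (hfh : ImagesCommute f h)
    (hfp : ImagesCommute f p) (hgh : ImagesCommute g h) (hgp : ImagesCommute g p)
    (hhp : ImagesCommute h p) :
    leg₃ f g h Φinv * leg₃ f (coprodLeg Δ g h hgh) p Φinv * leg₃ g h p Φinv =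
      leg₃ (coprodLeg Δ f g hfg) h p Φinv * leg₃ f g (coprodLeg Δ h p hhp) Φinv := by
  have key := congrArg (leg₄ f g h p) hqb.pentagon
  rw [leg₄_mul hfg hfh hfp hgh hgp hhp, leg₄_mul hfg hfh hfp hgh hgp hhp,
    leg₄_mul hfg hfh hfp hgh hgp hhp, leg₄_one_tmul, ← leg₃_coprodLeg_left hfg,
    ← leg₃_coprodLeg_mid hgh, ← leg₃_coprodLeg_right hhp, LinearMap.flip_apply,
    TensorProduct.mk_apply, leg₄_tmul, map_one, mul_one] at key
  refine left_inv_eq_right_inv (a := leg₃ g h p Φ * leg₃ f (coprodLeg Δ g h hgh) p Φ *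
    leg₃ f g h Φ) ?_ ?_
  · have b1 := hqb.leg₃_inv_mul hfg hfh hgh
    have b2 := hqb.leg₃_inv_mul (hfg.coprodLeg_right hfh hgh (Δ := Δ)) hfp
      (hgp.coprodLeg_left hhp hgh)
    have b3 := hqb.leg₃_inv_mul hgh hgp hhp
    simp only [mul_assoc]
    rw [← mul_assoc (leg₃ g h p Φinv), b3, one_mul, ← mul_assoc (leg₃ f _ p Φinv), b2, one_mul,
      b1]
  · have b4 := hqb.leg₃_phi_mul (hfh.coprodLeg_left hgh hfg (Δ := Δ))
      (hfp.coprodLeg_left hgp hfg) hhp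
    have b5 := hqb.leg₃_phi_mul hfg (hfh.coprodLeg_right hfp hhp (Δ := Δ))
      (hgh.coprodLeg_right hgp hhp)
    rw [← key, mul_assoc, ← mul_assoc (leg₃ _ h p Φ), b4, one_mul, b5]

theorem coprodLeg_counit_left (f : H →ₐ[k] B) :
    coprodLeg Δ (counitLeg B ε) f (.counitLeg_left f) = f := by
  ext x
  conv_rhs => rw [← hqb.counit_left x]
  rw [coprodLeg_apply, AlgHom.toLinearMap_apply]
  induction Δ x using TensorProduct.induction_on with
  | zero => simp
  | tmul x y => simp [Algebra.smul_def]
  | add s t hs ht => simp only [map_add, hs, ht]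

theorem coprodLeg_counit_right (f : H →ₐ[k] B) :
    coprodLeg Δ f (counitLeg B ε) (.counitLeg_right f) = f := by
  ext x
  conv_rhs => rw [← hqb.counit_right x]
  rw [coprodLeg_apply, AlgHom.toLinearMap_apply]
  induction Δ x using TensorProduct.induction_on with
  | zero => simp
  | tmul x y => simp [Algebra.smul_def, Algebra.commutes]
  | add s t hs ht => simp only [map_add, hs, ht]

theorem leg₃_counit_mid (hfg : ImagesCommute f g) : leg₃ f (counitLeg B ε) g Φinv = 1 := by
  have hΦ : leg₃ f (counitLeg B ε) g Φ = 1 := by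
    have key := congrArg (leg₂ f g) hqb.counit_phi
    rw [leg₂_tmul, map_one, map_one, mul_one] at key
    rw [← key]
    clear hqb key
    induction Φ using tensor_induction₃ with
    | zero => simp
    | tmul x y z => simp [Algebra.smul_def, Algebra.commutes]
    | add s t hs ht => simp only [map_add, hs, ht]
  simpa [hΦ] using hqb.leg₃_phi_mul (.counitLeg_right (ε := ε) f) hfg (.counitLeg_left g)

theorem leg₃_counit_left (hfg : ImagesCommute f g) : leg₃ (counitLeg B ε) f g Φinv = 1 := by
  have key := hqb.leg₃_pentagon (.counitLeg_left (ε := ε) (counitLeg B ε)) (.counitLeg_left f)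
    (.counitLeg_left g) (.counitLeg_left f) (.counitLeg_left g) hfg
  rw [hqb.coprodLeg_counit_left, hqb.coprodLeg_counit_left,
    hqb.leg₃_counit_mid (.counitLeg_left f), one_mul,
    hqb.leg₃_counit_mid (.counitLeg_left _), mul_one] at key
  have hinv := hqb.leg₃_phi_mul (.counitLeg_left (ε := ε) f) (.counitLeg_left g) hfg
  calc _ = leg₃ (counitLeg B ε) f g Φ *
        (leg₃ (counitLeg B ε) f g Φinv * leg₃ (counitLeg B ε) f g Φinv) := by
        rw [← mul_assoc, hinv, one_mul]
    _ = 1 := by rw [key, hinv]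

theorem leg₃_counit_right (hfg : ImagesCommute f g) : leg₃ f g (counitLeg B ε) Φinv = 1 := by
  have key := hqb.leg₃_pentagon hfg (.counitLeg_right (ε := ε) f) (.counitLeg_right f)
    (.counitLeg_right g) (.counitLeg_right (ε := ε) g) (.counitLeg_right (counitLeg B ε))
  rw [hqb.coprodLeg_counit_right, hqb.coprodLeg_counit_right,
    hqb.leg₃_counit_mid (.counitLeg_right _), mul_one,
    hqb.leg₃_counit_mid (.counitLeg_right _), one_mul] at key
  have hinv := hqb.leg₃_phi_mul hfg (.counitLeg_right (ε := ε) f) (.counitLeg_right g)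
  calc _ = leg₃ f g (counitLeg B ε) Φ *
        (leg₃ f g (counitLeg B ε) Φinv * leg₃ f g (counitLeg B ε) Φinv) := by
        rw [← mul_assoc, hinv, one_mul]
    _ = 1 := by rw [key, hinv]

end IsQuasiBialgebra

theorem mul_zigzag {M : Type*} [Monoid M]
    {w r s t u q A₁ A₂ A₃ A₄ b₁ b₂ b₃ b₄ c₁ c₂ c₃ c₄ x x' y y' z z' : M} (hw : w * r = 1)
    (h₁ : r * A₁ * s = b₁ * c₁) (h₂ : s * A₂ * t = b₂ * c₂) (h₃ : t * A₃ * u = b₃ * c₃)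
    (h₄ : u * A₄ * q = b₄ * c₄) (hx : s * x = x' * s) (hy : t * y = y' * t)
    (hz : u * z = z' * u) :
    w * b₁ * (c₁ * x * A₂ * y' * b₃) * (c₃ * z * A₄ * q) =
      A₁ * x' * b₂ * (c₂ * y * A₃ * z' * b₄) * c₄ :=
  calc _ = w * (b₁ * c₁) * x * A₂ * y' * (b₃ * c₃) * z * A₄ * q := by simp only [mul_assoc]
    _ = (w * r) * A₁ * (s * x) * A₂ * (y' * t) * A₃ * (u * z) * A₄ * q := by
      rw [← h₁, ← h₃]; simp only [mul_assoc]
    _ = A₁ * x' * (s * A₂ * t) * y * A₃ * z' * (u * A₄ * q) := by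
      rw [hw, hx, ← hy, hz]; simp only [mul_assoc, one_mul]
    _ = _ := by rw [h₂, h₄]; simp only [mul_assoc]

/-- `Φ⁻¹₁₂₃ Δ(x)₂₃ Φ⁻¹₂₃₄ Δ(y)₃₄ Φ⁻¹₃₄₅`, with the legs placed in `B` by `f₁, …, f₅`. -/
def smashKernel (Δ : H →ₐ[k] H ⊗[k] H) (Φinv : (H ⊗[k] H) ⊗[k] H)
    (f₁ f₂ f₃ f₄ f₅ : H →ₐ[k] B) (x y : H) : B :=
  leg₃ f₁ f₂ f₃ Φinv * leg₂ f₂ f₃ (Δ x) * leg₃ f₂ f₃ f₄ Φinv * leg₂ f₃ f₄ (Δ y) *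
    leg₃ f₃ f₄ f₅ Φinv

theorem map_smashKernel {C : Type*} [Ring C] [Algebra k C] (θ : B →ₐ[k] C)
    (f₁ f₂ f₃ f₄ f₅ : H →ₐ[k] B) (x y : H) :
    θ (smashKernel Δ Φinv f₁ f₂ f₃ f₄ f₅ x y) =
      smashKernel Δ Φinv (θ.comp f₁) (θ.comp f₂) (θ.comp f₃) (θ.comp f₄) (θ.comp f₅) x y := by
  simp only [smashKernel, map_mul, map_leg₂, map_leg₃]

theorem IsQuasiBialgebra.smashKernel_assoc (hqb : IsQuasiBialgebra Δ ε Φ Φinv)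
    (i : Fin 7 → H →ₐ[k] B) (hi : ∀ {a b}, a ≠ b → ImagesCommute (i a) (i b)) (x y z : H) :
    leg₃ (i 0) (i 1) (i 2) Φ *
      leg₃ (coprodLeg Δ (i 0) (i 1) (hi (by decide))) (i 2) (i 3) Φinv *
      smashKernel Δ Φinv (i 0) (i 1) (coprodLeg Δ (i 2) (i 3) (hi (by decide))) (i 4) (i 5) x y *
      (leg₃ (i 2) (i 3) (coprodLeg Δ (i 4) (i 5) (hi (by decide))) Φinv *
        leg₂ (i 3) (coprodLeg Δ (i 4) (i 5) (hi (by decide))) (Δ z) *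
        leg₃ (i 3) (coprodLeg Δ (i 4) (i 5) (hi (by decide))) (i 6) Φinv *
        leg₃ (i 4) (i 5) (i 6) Φinv) =
    leg₃ (i 0) (coprodLeg Δ (i 1) (i 2) (hi (by decide))) (i 3) Φinv *
      leg₂ (coprodLeg Δ (i 1) (i 2) (hi (by decide))) (i 3) (Δ x) *
      leg₃ (coprodLeg Δ (i 1) (i 2) (hi (by decide))) (i 3) (i 4) Φinv *
      smashKernel Δ Φinv (i 1) (i 2) (coprodLeg Δ (i 3) (i 4) (hi (by decide))) (i 5) (i 6) y z *
      leg₃ (i 3) (i 4) (coprodLeg Δ (i 5) (i 6) (hi (by decide))) Φinv := by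
  have inv := hqb.leg₃_phi_mul (hi (a := 0) (b := 1) (by decide))
    (hi (a := 0) (b := 2) (by decide)) (hi (by decide))
  have pent (a b c d : Fin 7) (h1 : a ≠ b) (h2 : a ≠ c) (h3 : a ≠ d) (h4 : b ≠ c) (h5 : b ≠ d)
      (h6 : c ≠ d) := hqb.leg₃_pentagon (hi h1) (hi h2) (hi h3) (hi h4) (hi h5) (hi h6)
  have p1 := pent 0 1 2 3 (by decide) (by decide) (by decide) (by decide) (by decide) (by decide)
  have p2 := pent 1 2 3 4 (by decide) (by decide) (by decide) (by decide) (by decide) (by decide)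
  have p3 := pent 2 3 4 5 (by decide) (by decide) (by decide) (by decide) (by decide) (by decide)
  have p4 := pent 3 4 5 6 (by decide) (by decide) (by decide) (by decide) (by decide) (by decide)
  have coas (a b c : Fin 7) (h1 : a ≠ b) (h2 : a ≠ c) (h3 : b ≠ c) :=
    hqb.leg₃_coassoc (hi h1) (hi h2) (hi h3)
  have c1 := coas 1 2 3 (by decide) (by decide) (by decide) x
  have c2 := coas 2 3 4 (by decide) (by decide) (by decide) y
  have c3 := coas 3 4 5 (by decide) (by decide) (by decide) z
  exact mul_zigzag inv p1 p2 p3 p4 c1 c2 c3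

end QuasiBialgebraLegs

section SmashProduct

variable {k : Type*} [Field k] {H : Type*} [Ring H] [Algebra k H]
  {A : Type*} [AddCommGroup A] [Module k A]

section Legs

/-! Without the following shortcuts, instance search fails on the tensor products below. -/

instance smashRing₅ : Ring ((H ⊗[k] H) ⊗[k] ((H ⊗[k] H) ⊗[k] H)) := inferInstance

instance smashAlgebra₅ : Algebra k ((H ⊗[k] H) ⊗[k] ((H ⊗[k] H) ⊗[k] H)) := inferInstance

instance smashRing₇ : Ring ((H ⊗[k] H) ⊗[k] ((H ⊗[k] H) ⊗[k] ((H ⊗[k] H) ⊗[k] H))) :=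
  inferInstance

instance smashAlgebra₇ :
    Algebra k ((H ⊗[k] H) ⊗[k] ((H ⊗[k] H) ⊗[k] ((H ⊗[k] H) ⊗[k] H))) :=
  inferInstance

theorem smash_induction₅ {p : (H ⊗[k] H) ⊗[k] ((H ⊗[k] H) ⊗[k] H) → Prop}
    (t : (H ⊗[k] H) ⊗[k] ((H ⊗[k] H) ⊗[k] H)) (zero : p 0)
    (tmul : ∀ x x' y y' c, p ((x ⊗ₜ x') ⊗ₜ ((y ⊗ₜ y') ⊗ₜ c)))
    (add : ∀ s t, p s → p t → p (s + t)) : p t := by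
  induction t using tensor_induction_right₃ with
  | zero => exact zero
  | add s t hs ht => exact add s t hs ht
  | tmul u v c =>
    induction u using TensorProduct.induction_on with
    | zero => simpa using zero
    | add s t hs ht => simpa only [add_tmul] using add _ _ hs ht
    | tmul x x' =>
      induction v using TensorProduct.induction_on with
      | zero => simpa using zero
      | add s t hs ht => simpa only [add_tmul, tmul_add] using add _ _ hs ht
      | tmul y y' => exact tmul x x' y y' c

theorem smash_induction₇
    {p : (H ⊗[k] H) ⊗[k] ((H ⊗[k] H) ⊗[k] ((H ⊗[k] H) ⊗[k] H)) → Prop}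
    (t : (H ⊗[k] H) ⊗[k] ((H ⊗[k] H) ⊗[k] ((H ⊗[k] H) ⊗[k] H))) (zero : p 0)
    (tmul : ∀ x x' y y' z z' c, p ((x ⊗ₜ x') ⊗ₜ ((y ⊗ₜ y') ⊗ₜ ((z ⊗ₜ z') ⊗ₜ c))))
    (add : ∀ s t, p s → p t → p (s + t)) : p t := by
  induction t using TensorProduct.induction_on with
  | zero => exact zero
  | add s t hs ht => exact add s t hs ht
  | tmul u v =>
    induction u using TensorProduct.induction_on with
    | zero => simpa using zero
    | add s t hs ht => simpa only [add_tmul] using add _ _ hs ht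
    | tmul x x' =>
      induction v using smash_induction₅ with
      | zero => simpa using zero
      | add s t hs ht => simpa only [tmul_add] using add _ _ hs ht
      | tmul y y' z z' c => exact tmul x x' y y' z z' c

variable (k H)

/-- The five legs acting on `A ⊗ A ⊗ H`, in the order: left on the first and on the second
factor, on `H`, right on the first and on the second factor. -/
def smashLeg₅ : Fin 5 → H →ₐ[k] (H ⊗[k] H) ⊗[k] ((H ⊗[k] H) ⊗[k] H) :=
  ![Algebra.TensorProduct.includeLeft.comp Algebra.TensorProduct.includeLeft,
    Algebra.TensorProduct.includeRight.comp
      (Algebra.TensorProduct.includeLeft.comp Algebra.TensorProduct.includeLeft),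
    Algebra.TensorProduct.includeRight.comp Algebra.TensorProduct.includeRight,
    Algebra.TensorProduct.includeLeft.comp Algebra.TensorProduct.includeRight,
    Algebra.TensorProduct.includeRight.comp
      (Algebra.TensorProduct.includeLeft.comp Algebra.TensorProduct.includeRight)]

/-- The seven legs acting on `A ⊗ A ⊗ A ⊗ H`, in the order: left on the three factors `A`,
on `H`, right on the three factors `A`. -/
def smashLeg₇ :
    Fin 7 → H →ₐ[k] (H ⊗[k] H) ⊗[k] ((H ⊗[k] H) ⊗[k] ((H ⊗[k] H) ⊗[k] H)) :=
  ![Algebra.TensorProduct.includeLeft.comp Algebra.TensorProduct.includeLeft,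
    Algebra.TensorProduct.includeRight.comp (smashLeg₅ k H 0),
    Algebra.TensorProduct.includeRight.comp (smashLeg₅ k H 1),
    Algebra.TensorProduct.includeRight.comp (smashLeg₅ k H 2),
    Algebra.TensorProduct.includeLeft.comp Algebra.TensorProduct.includeRight,
    Algebra.TensorProduct.includeRight.comp (smashLeg₅ k H 3),
    Algebra.TensorProduct.includeRight.comp (smashLeg₅ k H 4)]

variable {H}

@[simp] theorem smashLeg₅_zero (x : H) :
    smashLeg₅ k H 0 x = (x ⊗ₜ 1) ⊗ₜ ((1 ⊗ₜ 1) ⊗ₜ 1) := rfl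

@[simp] theorem smashLeg₅_one (x : H) :
    smashLeg₅ k H 1 x = (1 ⊗ₜ 1) ⊗ₜ ((x ⊗ₜ 1) ⊗ₜ 1) := rfl

@[simp] theorem smashLeg₅_two (x : H) :
    smashLeg₅ k H 2 x = (1 ⊗ₜ 1) ⊗ₜ ((1 ⊗ₜ 1) ⊗ₜ x) := rfl

@[simp] theorem smashLeg₅_three (x : H) :
    smashLeg₅ k H 3 x = (1 ⊗ₜ x) ⊗ₜ ((1 ⊗ₜ 1) ⊗ₜ 1) := rfl

@[simp] theorem smashLeg₅_four (x : H) :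
    smashLeg₅ k H 4 x = (1 ⊗ₜ 1) ⊗ₜ ((1 ⊗ₜ x) ⊗ₜ 1) := rfl

@[simp] theorem smashLeg₇_zero (x : H) :
    smashLeg₇ k H 0 x = (x ⊗ₜ 1) ⊗ₜ ((1 ⊗ₜ 1) ⊗ₜ ((1 ⊗ₜ 1) ⊗ₜ 1)) := rfl

@[simp] theorem smashLeg₇_one (x : H) :
    smashLeg₇ k H 1 x = (1 ⊗ₜ 1) ⊗ₜ ((x ⊗ₜ 1) ⊗ₜ ((1 ⊗ₜ 1) ⊗ₜ 1)) := rfl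

@[simp] theorem smashLeg₇_two (x : H) :
    smashLeg₇ k H 2 x = (1 ⊗ₜ 1) ⊗ₜ ((1 ⊗ₜ 1) ⊗ₜ ((x ⊗ₜ 1) ⊗ₜ 1)) := rfl

@[simp] theorem smashLeg₇_three (x : H) :
    smashLeg₇ k H 3 x = (1 ⊗ₜ 1) ⊗ₜ ((1 ⊗ₜ 1) ⊗ₜ ((1 ⊗ₜ 1) ⊗ₜ x)) := rfl

@[simp] theorem smashLeg₇_four (x : H) :
    smashLeg₇ k H 4 x = (1 ⊗ₜ x) ⊗ₜ ((1 ⊗ₜ 1) ⊗ₜ ((1 ⊗ₜ 1) ⊗ₜ 1)) := rfl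

@[simp] theorem smashLeg₇_five (x : H) :
    smashLeg₇ k H 5 x = (1 ⊗ₜ 1) ⊗ₜ ((1 ⊗ₜ x) ⊗ₜ ((1 ⊗ₜ 1) ⊗ₜ 1)) := rfl

@[simp] theorem smashLeg₇_six (x : H) :
    smashLeg₇ k H 6 x = (1 ⊗ₜ 1) ⊗ₜ ((1 ⊗ₜ 1) ⊗ₜ ((1 ⊗ₜ x) ⊗ₜ 1)) := rfl

variable {k}

theorem smashLeg₇_imagesCommute {a b : Fin 7} (hab : a ≠ b) :
    ImagesCommute (smashLeg₇ k H a) (smashLeg₇ k H b) := fun x y => by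
  rw [commute_iff_eq]
  fin_cases a <;> fin_cases b <;> simp at hab ⊢

variable (Δ : H →ₐ[k] H ⊗[k] H)

/-- `x ⊗ y ↦ (x₁ ⊗ y₁) ⊗ (x₂ ⊗ y₂)`. -/
def splitPair : H ⊗[k] H →ₐ[k] (H ⊗[k] H) ⊗[k] (H ⊗[k] H) :=
  (Algebra.TensorProduct.tensorTensorTensorComm k k k k H H H H).toAlgHom.comp
    (Algebra.TensorProduct.map Δ Δ)

/-- Splitting the legs acting on the first factor `A` by `Δ`. -/
def splitFirst : (H ⊗[k] H) ⊗[k] ((H ⊗[k] H) ⊗[k] H) →ₐ[k]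
    (H ⊗[k] H) ⊗[k] ((H ⊗[k] H) ⊗[k] ((H ⊗[k] H) ⊗[k] H)) :=
  (Algebra.TensorProduct.assoc k k k _ _ _).toAlgHom.comp
    (Algebra.TensorProduct.map (splitPair Δ) (AlgHom.id k _))

/-- Splitting the legs acting on the second factor `A` by `Δ`. -/
def splitSecond : (H ⊗[k] H) ⊗[k] ((H ⊗[k] H) ⊗[k] H) →ₐ[k]
    (H ⊗[k] H) ⊗[k] ((H ⊗[k] H) ⊗[k] ((H ⊗[k] H) ⊗[k] H)) :=
  Algebra.TensorProduct.map (AlgHom.id k _)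
    ((Algebra.TensorProduct.assoc k k k _ _ _).toAlgHom.comp
      (Algebra.TensorProduct.map (splitPair Δ) (AlgHom.id k _)))

/-- Splitting the leg `H` by `Δ` into the left leg of a third factor `A` and the leg `H`. -/
def splitMidLeft : (H ⊗[k] H) ⊗[k] ((H ⊗[k] H) ⊗[k] H) →ₐ[k]
    (H ⊗[k] H) ⊗[k] ((H ⊗[k] H) ⊗[k] ((H ⊗[k] H) ⊗[k] H)) :=
  Algebra.TensorProduct.map (AlgHom.id k _) (Algebra.TensorProduct.map (AlgHom.id k _)
    ((Algebra.TensorProduct.map Algebra.TensorProduct.includeLeft (AlgHom.id k H)).comp Δ))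

/-- Splitting the leg `H` by `Δ` into the leg `H` and the right leg of a new first factor `A`. -/
def splitMidRight : (H ⊗[k] H) ⊗[k] ((H ⊗[k] H) ⊗[k] H) →ₐ[k]
    (H ⊗[k] H) ⊗[k] ((H ⊗[k] H) ⊗[k] ((H ⊗[k] H) ⊗[k] H)) :=
  (Algebra.TensorProduct.leftComm k _ _ _).toAlgHom.comp
    (Algebra.TensorProduct.map (AlgHom.id k _)
      ((Algebra.TensorProduct.leftComm k _ _ _).toAlgHom.comp
        (Algebra.TensorProduct.map (AlgHom.id k _)
          ((Algebra.TensorProduct.map Algebra.TensorProduct.includeRight (AlgHom.id k H)).comp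
            ((Algebra.TensorProduct.comm k H H).toAlgHom.comp Δ)))))

theorem splitFirst_comp_zero : (splitFirst Δ).comp (smashLeg₅ k H 0) =
    coprodLeg Δ (smashLeg₇ k H 0) (smashLeg₇ k H 1)
      (smashLeg₇_imagesCommute (by decide)) := by
  ext x
  simp only [AlgHom.comp_apply, coprodLeg_apply]
  simp [splitFirst, splitPair, Algebra.TensorProduct.one_def]
  induction Δ x using TensorProduct.induction_on with
  | zero => simp
  | tmul x y => simp
  | add s t hs ht => simp only [map_add, add_tmul, hs, ht]

theorem splitFirst_comp_one : (splitFirst Δ).comp (smashLeg₅ k H 1) = smashLeg₇ k H 2 := by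
  ext x
  simp [splitFirst, splitPair, Algebra.TensorProduct.one_def]

theorem splitFirst_comp_two : (splitFirst Δ).comp (smashLeg₅ k H 2) = smashLeg₇ k H 3 := by
  ext x
  simp [splitFirst, splitPair, Algebra.TensorProduct.one_def]

theorem splitFirst_comp_three : (splitFirst Δ).comp (smashLeg₅ k H 3) =
    coprodLeg Δ (smashLeg₇ k H 4) (smashLeg₇ k H 5)
      (smashLeg₇_imagesCommute (by decide)) := by
  ext x
  simp only [AlgHom.comp_apply, coprodLeg_apply]
  simp [splitFirst, splitPair, Algebra.TensorProduct.one_def]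
  induction Δ x using TensorProduct.induction_on with
  | zero => simp
  | tmul x y => simp
  | add s t hs ht => simp only [map_add, add_tmul, tmul_add, hs, ht]

theorem splitFirst_comp_four : (splitFirst Δ).comp (smashLeg₅ k H 4) = smashLeg₇ k H 6 := by
  ext x
  simp [splitFirst, splitPair, Algebra.TensorProduct.one_def]

theorem splitSecond_comp_zero : (splitSecond Δ).comp (smashLeg₅ k H 0) = smashLeg₇ k H 0 := by
  ext x
  simp [splitSecond, splitPair, Algebra.TensorProduct.one_def]

theorem splitSecond_comp_one : (splitSecond Δ).comp (smashLeg₅ k H 1) =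
    coprodLeg Δ (smashLeg₇ k H 1) (smashLeg₇ k H 2)
      (smashLeg₇_imagesCommute (by decide)) := by
  ext x
  simp only [AlgHom.comp_apply, coprodLeg_apply]
  simp [splitSecond, splitPair, Algebra.TensorProduct.one_def]
  induction Δ x using TensorProduct.induction_on with
  | zero => simp
  | tmul x y => simp
  | add s t hs ht => simp only [map_add, add_tmul, tmul_add, hs, ht]

theorem splitSecond_comp_two : (splitSecond Δ).comp (smashLeg₅ k H 2) = smashLeg₇ k H 3 := by
  ext x
  simp [splitSecond, splitPair, Algebra.TensorProduct.one_def]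

theorem splitSecond_comp_three : (splitSecond Δ).comp (smashLeg₅ k H 3) = smashLeg₇ k H 4 := by
  ext x
  simp [splitSecond, splitPair, Algebra.TensorProduct.one_def]

theorem splitSecond_comp_four : (splitSecond Δ).comp (smashLeg₅ k H 4) =
    coprodLeg Δ (smashLeg₇ k H 5) (smashLeg₇ k H 6)
      (smashLeg₇_imagesCommute (by decide)) := by
  ext x
  simp only [AlgHom.comp_apply, coprodLeg_apply]
  simp [splitSecond, splitPair, Algebra.TensorProduct.one_def]
  induction Δ x using TensorProduct.induction_on with
  | zero => simp
  | tmul x y => simp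
  | add s t hs ht => simp only [map_add, add_tmul, tmul_add, hs, ht]

theorem splitMidLeft_comp_zero : (splitMidLeft Δ).comp (smashLeg₅ k H 0) = smashLeg₇ k H 0 := by
  ext x
  simp [splitMidLeft, Algebra.TensorProduct.one_def]

theorem splitMidLeft_comp_one : (splitMidLeft Δ).comp (smashLeg₅ k H 1) = smashLeg₇ k H 1 := by
  ext x
  simp [splitMidLeft, Algebra.TensorProduct.one_def]

theorem splitMidLeft_comp_two : (splitMidLeft Δ).comp (smashLeg₅ k H 2) =
    coprodLeg Δ (smashLeg₇ k H 2) (smashLeg₇ k H 3)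
      (smashLeg₇_imagesCommute (by decide)) := by
  ext x
  simp only [AlgHom.comp_apply, coprodLeg_apply]
  simp [splitMidLeft]
  induction Δ x using TensorProduct.induction_on with
  | zero => simp
  | tmul x y => simp
  | add s t hs ht => simp only [map_add, tmul_add, hs, ht]

theorem splitMidLeft_comp_three : (splitMidLeft Δ).comp (smashLeg₅ k H 3) = smashLeg₇ k H 4 := by
  ext x
  simp [splitMidLeft, Algebra.TensorProduct.one_def]

theorem splitMidLeft_comp_four : (splitMidLeft Δ).comp (smashLeg₅ k H 4) = smashLeg₇ k H 5 := by
  ext x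
  simp [splitMidLeft, Algebra.TensorProduct.one_def]

theorem splitMidRight_comp_zero : (splitMidRight Δ).comp (smashLeg₅ k H 0) = smashLeg₇ k H 1 := by
  ext x
  simp [splitMidRight, Algebra.TensorProduct.one_def]

theorem splitMidRight_comp_one : (splitMidRight Δ).comp (smashLeg₅ k H 1) = smashLeg₇ k H 2 := by
  ext x
  simp [splitMidRight, Algebra.TensorProduct.one_def]

theorem splitMidRight_comp_two : (splitMidRight Δ).comp (smashLeg₅ k H 2) =
    coprodLeg Δ (smashLeg₇ k H 3) (smashLeg₇ k H 4)
      (smashLeg₇_imagesCommute (by decide)) := by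
  ext x
  simp only [AlgHom.comp_apply, coprodLeg_apply]
  simp [splitMidRight]
  induction Δ x using TensorProduct.induction_on with
  | zero => simp
  | tmul x y => simp
  | add s t hs ht => simp only [map_add, tmul_add, hs, ht]

theorem splitMidRight_comp_three : (splitMidRight Δ).comp (smashLeg₅ k H 3) = smashLeg₇ k H 5 := by
  ext x
  simp [splitMidRight, Algebra.TensorProduct.one_def]

theorem splitMidRight_comp_four : (splitMidRight Δ).comp (smashLeg₅ k H 4) = smashLeg₇ k H 6 := by
  ext x
  simp [splitMidRight, Algebra.TensorProduct.one_def]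

end Legs

section Actions

variable (actL : H ⊗[k] A →ₗ[k] A) (actR : A ⊗[k] H →ₗ[k] A) (mulA : A ⊗[k] A →ₗ[k] A)

/-- `x ⊗ y ↦ x · φ · y`. -/
def sandwich : A →ₗ[k] H ⊗[k] H →ₗ[k] A := TensorProduct.curry (triAct actL actR ∘ₗ cc)

@[simp] theorem sandwich_tmul (φ : A) (x y : H) :
    sandwich actL actR φ (x ⊗ₜ y) = actR (actL (x ⊗ₜ φ) ⊗ₜ y) := by
  simp [sandwich, triAct]

/-- `(a ⊗ d) ⊗ ((b ⊗ e) ⊗ c) ↦ (a · φ · d)(b · φ' · e) ⊗ c`. -/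
def smashEval₅ (φ φ' : A) : (H ⊗[k] H) ⊗[k] ((H ⊗[k] H) ⊗[k] H) →ₗ[k] A ⊗[k] H :=
  rTensor H mulA ∘ₗ osa ∘ₗ
    TensorProduct.map (sandwich actL actR φ)
      (TensorProduct.map (sandwich actL actR φ') LinearMap.id)

@[simp] theorem smashEval₅_tmul (φ φ' : A) (s t : H ⊗[k] H) (c : H) :
    smashEval₅ actL actR mulA φ φ' (s ⊗ₜ (t ⊗ₜ c)) =
      mulA (sandwich actL actR φ s ⊗ₜ sandwich actL actR φ' t) ⊗ₜ c := by
  simp [smashEval₅]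

/-- `(a ⊗ a') ⊗ ((b ⊗ b') ⊗ ((c ⊗ c') ⊗ h)) ↦ (a · φ · a')((b · φ' · b')(c · φ'' · c')) ⊗ h`. -/
def smashEval₇ (φ φ' φ'' : A) :
    (H ⊗[k] H) ⊗[k] ((H ⊗[k] H) ⊗[k] ((H ⊗[k] H) ⊗[k] H)) →ₗ[k] A ⊗[k] H :=
  rTensor H (mulA ∘ₗ lTensor A mulA) ∘ₗ osa ∘ₗ lTensor A osa ∘ₗ
    TensorProduct.map (sandwich actL actR φ)
      (TensorProduct.map (sandwich actL actR φ')
        (TensorProduct.map (sandwich actL actR φ'') LinearMap.id))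

@[simp] theorem smashEval₇_tmul (φ φ' φ'' : A) (r s t : H ⊗[k] H) (c : H) :
    smashEval₇ actL actR mulA φ φ' φ'' (r ⊗ₜ (s ⊗ₜ (t ⊗ₜ c))) =
      mulA (sandwich actL actR φ r ⊗ₜ
        mulA (sandwich actL actR φ' s ⊗ₜ sandwich actL actR φ'' t)) ⊗ₜ c := by
  simp [smashEval₇]

theorem quasiAct_tmul (x₁ x₂ x₃ y₁ y₂ y₃ : H) (φ φ' φ'' : A) :
    quasiAct actL actR mulA
        (((x₁ ⊗ₜ x₂) ⊗ₜ x₃) ⊗ₜ (((y₁ ⊗ₜ y₂) ⊗ₜ y₃) ⊗ₜ ((φ ⊗ₜ φ') ⊗ₜ φ''))) =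
      mulA (sandwich actL actR φ (x₁ ⊗ₜ y₁) ⊗ₜ
        mulA (sandwich actL actR φ' (x₂ ⊗ₜ y₂) ⊗ₜ sandwich actL actR φ'' (x₃ ⊗ₜ y₃))) := by
  simp [quasiAct, zip3, biact]

end Actions

theorem smashRHS_eq (actL : H ⊗[k] A →ₗ[k] A) (actR : A ⊗[k] H →ₗ[k] A)
    (mulA : A ⊗[k] A →ₗ[k] A) (Δ : H →ₐ[k] H ⊗[k] H) (Φinv : (H ⊗[k] H) ⊗[k] H)
    (φ φ' : A) (h h' : H) :
    smashRHS actL actR mulA Δ Φinv φ φ' h h' =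
      smashEval₅ actL actR mulA φ φ' (smashKernel Δ Φinv (smashLeg₅ k H 0) (smashLeg₅ k H 1)
        (smashLeg₅ k H 2) (smashLeg₅ k H 3) (smashLeg₅ k H 4) h h') := by
  have key : ∀ (X Y Z : (H ⊗[k] H) ⊗[k] H) (s t : H ⊗[k] H),
      cc (TensorProduct.map smashF mulA
        (lTensor (H ⊗[k] (H ⊗[k] (H ⊗[k] (H ⊗[k] H))))
          (TensorProduct.map (smashL actL actR) (smashR actL actR) ∘ₗ tt)
          (aso (rTensor (A ⊗[k] A) cc
            ((rTensor (H ⊗[k] (H ⊗[k] (H ⊗[k] (H ⊗[k] H)))) tt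
              (tt (X ⊗ₜ (TensorProduct.map ins2 LinearMap.id
                (tt (s ⊗ₜ TensorProduct.map ins1 lc (tt (cc t ⊗ₜ
                  zip3 (((osa ∘ₗ cc) Z) ⊗ₜ ((cc ∘ₗ
                    (aso : (H ⊗[k] H) ⊗[k] H →ₗ[k] H ⊗[k] (H ⊗[k] H))) Y)))))))))) ⊗ₜ
              (φ ⊗ₜ φ')))))) =
        smashEval₅ actL actR mulA φ φ'
          (leg₃ (smashLeg₅ k H 0) (smashLeg₅ k H 1) (smashLeg₅ k H 2) X *
            leg₂ (smashLeg₅ k H 1) (smashLeg₅ k H 2) s *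
            leg₃ (smashLeg₅ k H 1) (smashLeg₅ k H 2) (smashLeg₅ k H 3) Z *
            leg₂ (smashLeg₅ k H 2) (smashLeg₅ k H 3) t *
            leg₃ (smashLeg₅ k H 2) (smashLeg₅ k H 3) (smashLeg₅ k H 4) Y) := by
    intro X Y Z s t
    induction X using tensor_induction₃ with
    | zero => simp
    | add s t hs ht => simp only [map_add, add_tmul, add_mul, hs, ht]
    | tmul x₁ x₂ x₃ =>
    induction s using TensorProduct.induction_on with
    | zero => simp
    | add s t hs ht => simp only [map_add, add_tmul, tmul_add, mul_add, add_mul, hs, ht]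
    | tmul s₁ s₂ =>
    induction Z using tensor_induction₃ with
    | zero => simp
    | add s t hs ht => simp only [map_add, add_tmul, tmul_add, mul_add, add_mul, hs, ht]
    | tmul z₁ z₂ z₃ =>
    induction t using TensorProduct.induction_on with
    | zero => simp
    | add s t hs ht => simp only [map_add, add_tmul, tmul_add, mul_add, add_mul, hs, ht]
    | tmul t₁ t₂ =>
    induction Y using tensor_induction₃ with
    | zero => simp
    | add s t hs ht => simp only [map_add, add_tmul, tmul_add, mul_add, hs, ht]
    | tmul y₁ y₂ y₃ =>
      simp [smashF, smashL, smashR, ins1, ins2, zip3, triAct, mul_assoc]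
  exact key Φinv Φinv Φinv (Δ h) (Δ h')

section Multiplication

variable (actL : H ⊗[k] A →ₗ[k] A) (actR : A ⊗[k] H →ₗ[k] A) (mulA : A ⊗[k] A →ₗ[k] A)
  (Δ : H →ₐ[k] H ⊗[k] H) (Φinv : (H ⊗[k] H) ⊗[k] H)

/-- The kernel of the L-R-smash product, acting on `A ⊗ A ⊗ H`. -/
def smashKernel₅ (x y : H) : (H ⊗[k] H) ⊗[k] ((H ⊗[k] H) ⊗[k] H) :=
  smashKernel Δ Φinv (smashLeg₅ k H 0) (smashLeg₅ k H 1) (smashLeg₅ k H 2) (smashLeg₅ k H 3)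
    (smashLeg₅ k H 4) x y

/-- The multiplication of the L-R-smash product. -/
def smashMul : A ⊗[k] H →ₗ[k] A ⊗[k] H →ₗ[k] A ⊗[k] H :=
  TensorProduct.lift (LinearMap.mk₂ k
    (fun φ h => TensorProduct.lift (LinearMap.mk₂ k
      (fun φ' h' => smashEval₅ actL actR mulA φ φ' (smashKernel₅ Δ Φinv h h'))
      (fun φ₁ φ₂ h' => by
        simp only [smashEval₅, map_add, TensorProduct.map_add_left, TensorProduct.map_add_right,
          LinearMap.comp_add, LinearMap.add_apply])
      (fun c φ' h' => by
        simp only [smashEval₅, map_smul, TensorProduct.map_smul_left,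
          TensorProduct.map_smul_right, LinearMap.comp_smul, LinearMap.smul_apply])
      (fun φ' h₁ h₂ => by simp only [smashKernel₅, smashKernel, map_add, mul_add, add_mul])
      (fun c φ' h' => by
        simp only [smashKernel₅, smashKernel, map_smul, mul_smul_comm, smul_mul_assoc])))
    (fun φ₁ φ₂ h => TensorProduct.ext' fun φ' h' => by
      simp [smashEval₅, TensorProduct.map_add_left, LinearMap.comp_add])
    (fun c φ h => TensorProduct.ext' fun φ' h' => by
      simp [smashEval₅, TensorProduct.map_smul_left, LinearMap.comp_smul])
    (fun φ h₁ h₂ => TensorProduct.ext' fun φ' h' => by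
      simp [smashKernel₅, smashKernel, mul_add, add_mul])
    (fun c φ h => TensorProduct.ext' fun φ' h' => by
      simp [smashKernel₅, smashKernel]))

theorem smashMul_tmul (φ φ' : A) (h h' : H) :
    smashMul actL actR mulA Δ Φinv (φ ⊗ₜ h) (φ' ⊗ₜ h') =
      smashEval₅ actL actR mulA φ φ' (smashKernel₅ Δ Φinv h h') := by
  simp only [smashMul, TensorProduct.lift.tmul]
  rfl

end Multiplication

section Split

variable (Δ : H →ₐ[k] H ⊗[k] H)

theorem splitMidLeft_tmul (a b c d e : H) :
    splitMidLeft Δ ((a ⊗ₜ d) ⊗ₜ ((b ⊗ₜ e) ⊗ₜ c)) =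
      smashLeg₇ k H 0 a * smashLeg₇ k H 1 b *
        leg₂ (smashLeg₇ k H 2) (smashLeg₇ k H 3) (Δ c) *
        (smashLeg₇ k H 4 d * smashLeg₇ k H 5 e) := by
  simp only [splitMidLeft, Algebra.TensorProduct.map_tmul, AlgHom.comp_apply, AlgHom.id_apply]
  induction Δ c using TensorProduct.induction_on with
  | zero => simp
  | tmul x y => simp
  | add s t hs ht => simp only [map_add, tmul_add, mul_add, add_mul, hs, ht]

theorem splitMidRight_tmul (a b c d e : H) :
    splitMidRight Δ ((a ⊗ₜ d) ⊗ₜ ((b ⊗ₜ e) ⊗ₜ c)) =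
      smashLeg₇ k H 1 a * smashLeg₇ k H 2 b *
        leg₂ (smashLeg₇ k H 3) (smashLeg₇ k H 4) (Δ c) *
        (smashLeg₇ k H 5 d * smashLeg₇ k H 6 e) := by
  simp only [splitMidRight, Algebra.TensorProduct.map_tmul, AlgHom.comp_apply, AlgHom.id_apply]
  induction Δ c using TensorProduct.induction_on with
  | zero => simp
  | tmul x y => simp
  | add s t hs ht => simp only [map_add, tmul_add, mul_add, add_mul, hs, ht]

end Split

theorem mul_swap_ends {M : Type*} [Monoid M] {p q l m r : M} (hpl : Commute p l)
    (hpm : Commute p m) (hqm : Commute q m) (hqr : Commute q r) (hpq : Commute p q) :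
    p * (l * m * r) * q = l * (q * m * p) * r :=
  calc p * (l * m * r) * q = (p * l) * m * (r * q) := by simp only [mul_assoc]
    _ = l * (p * m * q) * r := by rw [hpl.eq, ← hqr.eq]; simp only [mul_assoc]
    _ = l * (q * m * p) * r := by rw [hpm.eq, mul_assoc m, hpq.eq, ← mul_assoc m, ← hqm.eq]

section Swap

variable {B : Type*} [Ring B] [Algebra k B] {Δ : H →ₐ[k] H ⊗[k] H}
  (i : Fin 7 → H →ₐ[k] B) (hi : ∀ {a b : Fin 7}, a ≠ b → ImagesCommute (i a) (i b))

include hi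

theorem smashKernel_swap_left (Φ Φinv : (H ⊗[k] H) ⊗[k] H) (a b c d e h : H) :
    (i 4 d * i 5 e) *
        (leg₃ (i 0) (i 1) (i 2) Φ *
          smashKernel Δ Φinv (coprodLeg Δ (i 0) (i 1) (hi (by decide))) (i 2) (i 3)
            (coprodLeg Δ (i 4) (i 5) (hi (by decide))) (i 6) c h *
          leg₃ (i 4) (i 5) (i 6) Φinv) *
        (i 0 a * i 1 b) =
      leg₃ (i 0) (i 1) (i 2) Φ *
        leg₃ (coprodLeg Δ (i 0) (i 1) (hi (by decide))) (i 2) (i 3) Φinv *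
        (i 0 a * i 1 b * leg₂ (i 2) (i 3) (Δ c) * (i 4 d * i 5 e)) *
        (leg₃ (i 2) (i 3) (coprodLeg Δ (i 4) (i 5) (hi (by decide))) Φinv *
          leg₂ (i 3) (coprodLeg Δ (i 4) (i 5) (hi (by decide))) (Δ h) *
          leg₃ (i 3) (coprodLeg Δ (i 4) (i 5) (hi (by decide))) (i 6) Φinv *
          leg₃ (i 4) (i 5) (i 6) Φinv) := by
  have hleft (j : Fin 7) (x : H) (h₀ : j ≠ 0) (h₁ : j ≠ 1) (h₂ : j ≠ 2) (h₃ : j ≠ 3) :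
      Commute (i j x) (leg₃ (i 0) (i 1) (i 2) Φ *
        leg₃ (coprodLeg Δ (i 0) (i 1) (hi (by decide))) (i 2) (i 3) Φinv) :=
    (commute_leg₃ (hi h₀ x) (hi h₁ x) (hi h₂ x) _).mul_right
      (commute_leg₃ ((hi h₀).coprodLeg_right (hi h₁) (hi (by decide)) x) (hi h₂ x) (hi h₃ x) _)
  have hmid (j : Fin 7) (x : H) (h₂ : j ≠ 2) (h₃ : j ≠ 3) :
      Commute (i j x) (leg₂ (i 2) (i 3) (Δ c)) := commute_leg₂ (hi h₂ x) (hi h₃ x) _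
  have hright (j : Fin 7) (x : H) (h₂ : j ≠ 2) (h₃ : j ≠ 3) (h₄ : j ≠ 4) (h₅ : j ≠ 5)
      (h₆ : j ≠ 6) :
      Commute (i j x) (leg₃ (i 2) (i 3) (coprodLeg Δ (i 4) (i 5) (hi (by decide))) Φinv *
        leg₂ (i 3) (coprodLeg Δ (i 4) (i 5) (hi (by decide))) (Δ h) *
        leg₃ (i 3) (coprodLeg Δ (i 4) (i 5) (hi (by decide))) (i 6) Φinv *
        leg₃ (i 4) (i 5) (i 6) Φinv) := by
    have h₄₅ := (hi h₄).coprodLeg_right (Δ := Δ) (hi h₅) (hi (by decide))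
    exact (((commute_leg₃ (hi h₂ x) (hi h₃ x) (h₄₅ x) _).mul_right
      (commute_leg₂ (hi h₃ x) (h₄₅ x) _)).mul_right
      (commute_leg₃ (hi h₃ x) (h₄₅ x) (hi h₆ x) _)).mul_right
      (commute_leg₃ (hi h₄ x) (hi h₅ x) (hi h₆ x) _)
  rw [← mul_swap_ends (p := i 4 d * i 5 e) (q := i 0 a * i 1 b)
    ((hleft 4 d (by decide) (by decide) (by decide) (by decide)).mul_left
      (hleft 5 e (by decide) (by decide) (by decide) (by decide)))
    ((hmid 4 d (by decide) (by decide)).mul_left (hmid 5 e (by decide) (by decide)))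
    ((hmid 0 a (by decide) (by decide)).mul_left (hmid 1 b (by decide) (by decide)))
    ((hright 0 a (by decide) (by decide) (by decide) (by decide) (by decide)).mul_left
      (hright 1 b (by decide) (by decide) (by decide) (by decide) (by decide)))
    (((hi (by decide) d a).mul_right (hi (by decide) d b)).mul_left
      ((hi (by decide) e a).mul_right (hi (by decide) e b)))]
  simp only [smashKernel, mul_assoc]

theorem smashKernel_swap_right (Φinv : (H ⊗[k] H) ⊗[k] H) (a b c d e h : H) :
    (i 5 d * i 6 e) *
        smashKernel Δ Φinv (i 0) (coprodLeg Δ (i 1) (i 2) (hi (by decide))) (i 3) (i 4)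
          (coprodLeg Δ (i 5) (i 6) (hi (by decide))) h c *
        (i 1 a * i 2 b) =
      leg₃ (i 0) (coprodLeg Δ (i 1) (i 2) (hi (by decide))) (i 3) Φinv *
        leg₂ (coprodLeg Δ (i 1) (i 2) (hi (by decide))) (i 3) (Δ h) *
        leg₃ (coprodLeg Δ (i 1) (i 2) (hi (by decide))) (i 3) (i 4) Φinv *
        (i 1 a * i 2 b * leg₂ (i 3) (i 4) (Δ c) * (i 5 d * i 6 e)) *
        leg₃ (i 3) (i 4) (coprodLeg Δ (i 5) (i 6) (hi (by decide))) Φinv := by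
  have hleft (j : Fin 7) (x : H) (h₀ : j ≠ 0) (h₁ : j ≠ 1) (h₂ : j ≠ 2) (h₃ : j ≠ 3)
      (h₄ : j ≠ 4) :
      Commute (i j x) (leg₃ (i 0) (coprodLeg Δ (i 1) (i 2) (hi (by decide))) (i 3) Φinv *
        leg₂ (coprodLeg Δ (i 1) (i 2) (hi (by decide))) (i 3) (Δ h) *
        leg₃ (coprodLeg Δ (i 1) (i 2) (hi (by decide))) (i 3) (i 4) Φinv) := by
    have h₁₂ := (hi h₁).coprodLeg_right (Δ := Δ) (hi h₂) (hi (by decide))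
    exact ((commute_leg₃ (hi h₀ x) (h₁₂ x) (hi h₃ x) _).mul_right
      (commute_leg₂ (h₁₂ x) (hi h₃ x) _)).mul_right
      (commute_leg₃ (h₁₂ x) (hi h₃ x) (hi h₄ x) _)
  have hmid (j : Fin 7) (x : H) (h₃ : j ≠ 3) (h₄ : j ≠ 4) :
      Commute (i j x) (leg₂ (i 3) (i 4) (Δ c)) := commute_leg₂ (hi h₃ x) (hi h₄ x) _
  have hright (j : Fin 7) (x : H) (h₃ : j ≠ 3) (h₄ : j ≠ 4) (h₅ : j ≠ 5) (h₆ : j ≠ 6) :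
      Commute (i j x) (leg₃ (i 3) (i 4) (coprodLeg Δ (i 5) (i 6) (hi (by decide))) Φinv) :=
    commute_leg₃ (hi h₃ x) (hi h₄ x) ((hi h₅).coprodLeg_right (hi h₆) (hi (by decide)) x) _
  rw [← mul_swap_ends (p := i 5 d * i 6 e) (q := i 1 a * i 2 b)
    ((hleft 5 d (by decide) (by decide) (by decide) (by decide) (by decide)).mul_left
      (hleft 6 e (by decide) (by decide) (by decide) (by decide) (by decide)))
    ((hmid 5 d (by decide) (by decide)).mul_left (hmid 6 e (by decide) (by decide)))
    ((hmid 1 a (by decide) (by decide)).mul_left (hmid 2 b (by decide) (by decide)))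
    ((hright 1 a (by decide) (by decide) (by decide) (by decide)).mul_left
      (hright 2 b (by decide) (by decide) (by decide) (by decide)))
    (((hi (by decide) d a).mul_right (hi (by decide) d b)).mul_left
      ((hi (by decide) e a).mul_right (hi (by decide) e b)))]
  simp only [smashKernel, mul_assoc]

end Swap

section Counit

variable {B : Type*} [Ring B] [Algebra k B] {Δ : H →ₐ[k] H ⊗[k] H} {ε : H →ₐ[k] k}
  {Φ Φinv : (H ⊗[k] H) ⊗[k] H} {f g p : H →ₐ[k] B}

theorem IsQuasiBialgebra.smashKernel_counit_left (hqb : IsQuasiBialgebra Δ ε Φ Φinv)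
    (hfg : ImagesCommute f g) (hgp : ImagesCommute g p) (x : H) :
    smashKernel Δ Φinv (counitLeg B ε) f g (counitLeg B ε) p 1 x = g x := by
  rw [smashKernel, hqb.leg₃_counit_left hfg, map_one, leg₂_one, hqb.leg₃_counit_right hfg,
    ← coprodLeg_apply Δ (.counitLeg_right g), hqb.coprodLeg_counit_right,
    hqb.leg₃_counit_mid hgp]
  simp

theorem IsQuasiBialgebra.smashKernel_counit_right (hqb : IsQuasiBialgebra Δ ε Φ Φinv)
    (hfg : ImagesCommute f g) (hgp : ImagesCommute g p) (x : H) :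
    smashKernel Δ Φinv f (counitLeg B ε) g p (counitLeg B ε) x 1 = g x := by
  rw [smashKernel, hqb.leg₃_counit_mid hfg, ← coprodLeg_apply Δ (.counitLeg_left g),
    hqb.coprodLeg_counit_left, hqb.leg₃_counit_left hgp, map_one, leg₂_one,
    hqb.leg₃_counit_right hgp]
  simp

variable (ε)

/-- `x ⊗ y ↦ ε(x) ε(y)`. -/
def counitPair : H ⊗[k] H →ₐ[k] k :=
  (Algebra.TensorProduct.lid k k).toAlgHom.comp (Algebra.TensorProduct.map ε ε)

@[simp] theorem counitPair_tmul (x y : H) : counitPair ε (x ⊗ₜ y) = ε x * ε y := by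
  simp [counitPair]

/-- Applying the counit to the legs acting on the first factor `A`. -/
def killFirst : (H ⊗[k] H) ⊗[k] ((H ⊗[k] H) ⊗[k] H) →ₐ[k] (H ⊗[k] H) ⊗[k] H :=
  (Algebra.TensorProduct.lid k _).toAlgHom.comp
    (Algebra.TensorProduct.map (counitPair ε) (AlgHom.id k _))

/-- Applying the counit to the legs acting on the second factor `A`. -/
def killSecond : (H ⊗[k] H) ⊗[k] ((H ⊗[k] H) ⊗[k] H) →ₐ[k] (H ⊗[k] H) ⊗[k] H :=
  Algebra.TensorProduct.map (AlgHom.id k _)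
    ((Algebra.TensorProduct.lid k _).toAlgHom.comp
      (Algebra.TensorProduct.map (counitPair ε) (AlgHom.id k _)))

@[simp] theorem killFirst_tmul (s t : H ⊗[k] H) (c : H) :
    killFirst ε (s ⊗ₜ (t ⊗ₜ c)) = counitPair ε s • (t ⊗ₜ c) := by
  simp [killFirst]

@[simp] theorem killSecond_tmul (s t : H ⊗[k] H) (c : H) :
    killSecond ε (s ⊗ₜ (t ⊗ₜ c)) = counitPair ε t • (s ⊗ₜ c) := by
  simp [killSecond]

theorem killFirst_smashKernel₅ (hqb : IsQuasiBialgebra Δ ε Φ Φinv) (x : H) :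
    killFirst ε (smashKernel₅ Δ Φinv 1 x) = 1 ⊗ₜ x := by
  have h₀ : (killFirst ε).comp (smashLeg₅ k H 0) = counitLeg _ ε := by
    ext x
    simp [Algebra.TensorProduct.one_def, Algebra.algebraMap_eq_smul_one]
  have h₃ : (killFirst ε).comp (smashLeg₅ k H 3) = counitLeg _ ε := by
    ext x
    simp [Algebra.TensorProduct.one_def, Algebra.algebraMap_eq_smul_one]
  rw [smashKernel₅, map_smashKernel, h₀, h₃, hqb.smashKernel_counit_left]
  · simp [Algebra.TensorProduct.one_def]
  · intro x y
    simp [commute_iff_eq]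
  · intro x y
    simp [commute_iff_eq]

theorem killSecond_smashKernel₅ (hqb : IsQuasiBialgebra Δ ε Φ Φinv) (x : H) :
    killSecond ε (smashKernel₅ Δ Φinv x 1) = 1 ⊗ₜ x := by
  have h₁ : (killSecond ε).comp (smashLeg₅ k H 1) = counitLeg _ ε := by
    ext x
    simp [Algebra.TensorProduct.one_def, Algebra.algebraMap_eq_smul_one]
  have h₄ : (killSecond ε).comp (smashLeg₅ k H 4) = counitLeg _ ε := by
    ext x
    simp [Algebra.TensorProduct.one_def, Algebra.algebraMap_eq_smul_one]
  rw [smashKernel₅, map_smashKernel, h₁, h₄, hqb.smashKernel_counit_right]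
  · simp [Algebra.TensorProduct.one_def]
  · intro x y
    simp [commute_iff_eq]
  · intro x y
    simp [commute_iff_eq]

end Counit

namespace IsBimoduleAlgebra

variable {actL : H ⊗[k] A →ₗ[k] A} {actR : A ⊗[k] H →ₗ[k] A} {mulA : A ⊗[k] A →ₗ[k] A}
  {Δ : H →ₐ[k] H ⊗[k] H} {ε : H →ₐ[k] k} {Φ Φinv : (H ⊗[k] H) ⊗[k] H} {oneA : A}
  (hba : IsBimoduleAlgebra actL actR mulA Δ ε Φ Φinv oneA)

include hba

theorem sandwich_sandwich (x y : H) (φ : A) (t : H ⊗[k] H) :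
    actR (actL (x ⊗ₜ sandwich actL actR φ t) ⊗ₜ y) =
      sandwich actL actR φ ((x ⊗ₜ 1) * t * (1 ⊗ₜ y)) := by
  induction t using TensorProduct.induction_on with
  | zero => simp
  | tmul a b => simp [← hba.actL_actR, hba.actL_actL, hba.actR_actR]
  | add s t hs ht => simp only [map_add, add_tmul, tmul_add, mul_add, add_mul, hs, ht]

theorem sandwich_comp (x y a b : H) (φ : A) :
    sandwich actL actR (sandwich actL actR φ (x ⊗ₜ y)) (a ⊗ₜ b) =
      sandwich actL actR φ ((a * x) ⊗ₜ (y * b)) := by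
  simp [← hba.actL_actR, hba.actL_actL, hba.actR_actR]

theorem sandwich_mulA (φ φ' : A) (t : H ⊗[k] H) :
    sandwich actL actR (mulA (φ ⊗ₜ φ')) t =
      mulA (TensorProduct.map (sandwich actL actR φ) (sandwich actL actR φ')
        (splitPair Δ t)) := by
  induction t using TensorProduct.induction_on with
  | zero => simp
  | add s t hs ht => simp only [map_add, hs, ht]
  | tmul a d =>
    rw [sandwich_tmul, hba.actL_mulA]
    simp only [splitPair, AlgHom.comp_apply, AlgHom.toLinearMap_apply,
      Algebra.TensorProduct.map_tmul]
    induction Δ a using TensorProduct.induction_on with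
    | zero => simp
    | add s t hs ht => simp only [map_add, add_tmul, hs, ht]
    | tmul a a' =>
      simp only [tt_tmul, TensorProduct.map_tmul, hba.actR_mulA, AlgHom.toLinearMap_apply]
      induction Δ d using TensorProduct.induction_on with
      | zero => simp
      | add s t hs ht => simp only [map_add, tmul_add, hs, ht]
      | tmul d d' => simp

theorem mulA_assoc_tmul (φ φ' φ'' : A) (r s t : H ⊗[k] H) (c : H) :
    mulA (mulA (sandwich actL actR φ r ⊗ₜ sandwich actL actR φ' s) ⊗ₜ
        sandwich actL actR φ'' t) ⊗ₜ c =
      smashEval₇ actL actR mulA φ φ' φ''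
        (leg₃ (smashLeg₇ k H 0) (smashLeg₇ k H 1) (smashLeg₇ k H 2) Φ *
          (r ⊗ₜ (s ⊗ₜ (t ⊗ₜ c))) *
          leg₃ (smashLeg₇ k H 4) (smashLeg₇ k H 5) (smashLeg₇ k H 6) Φinv) := by
  rw [hba.quasi_assoc]
  generalize hX : Φ = X
  generalize hY : Φinv = Y
  clear hX hY
  induction X using tensor_induction₃ with
  | zero => simp
  | add s t hs ht => simp only [map_add, add_tmul, add_mul, hs, ht]
  | tmul x₁ x₂ x₃ =>
    induction Y using tensor_induction₃ with
    | zero => simp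
    | add s t hs ht => simp only [map_add, add_tmul, tmul_add, mul_add, hs, ht]
    | tmul y₁ y₂ y₃ =>
      rw [quasiAct_tmul]
      simp only [sandwich_tmul, hba.sandwich_sandwich]
      simp

theorem smashEval₅_mulA_left (φ φ' φ'' : A) (t : (H ⊗[k] H) ⊗[k] ((H ⊗[k] H) ⊗[k] H)) :
    smashEval₅ actL actR mulA (mulA (φ ⊗ₜ φ')) φ'' t =
      smashEval₇ actL actR mulA φ φ' φ''
        (leg₃ (smashLeg₇ k H 0) (smashLeg₇ k H 1) (smashLeg₇ k H 2) Φ * splitFirst Δ t *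
          leg₃ (smashLeg₇ k H 4) (smashLeg₇ k H 5) (smashLeg₇ k H 6) Φinv) := by
  induction t using tensor_induction_right₃ with
  | zero => simp
  | add s t hs ht => simp only [map_add, add_mul, mul_add, hs, ht]
  | tmul r s c =>
    simp only [smashEval₅_tmul, hba.sandwich_mulA, splitFirst, AlgHom.comp_apply,
      Algebra.TensorProduct.map_tmul, AlgHom.id_apply]
    induction splitPair Δ r using TensorProduct.induction_on with
    | zero => simp
    | add s t hs ht => simp only [map_add, add_tmul, add_mul, mul_add, hs, ht]
    | tmul u v => exact hba.mulA_assoc_tmul φ φ' φ'' u v s c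

theorem smashEval₅_mulA_right (φ φ' φ'' : A) (t : (H ⊗[k] H) ⊗[k] ((H ⊗[k] H) ⊗[k] H)) :
    smashEval₅ actL actR mulA φ (mulA (φ' ⊗ₜ φ'')) t =
      smashEval₇ actL actR mulA φ φ' φ'' (splitSecond Δ t) := by
  induction t using tensor_induction_right₃ with
  | zero => simp
  | add s t hs ht => simp only [map_add, hs, ht]
  | tmul r s c =>
    simp only [smashEval₅_tmul, hba.sandwich_mulA, splitSecond, AlgHom.comp_apply,
      Algebra.TensorProduct.map_tmul, AlgHom.id_apply]
    induction splitPair Δ s using TensorProduct.induction_on with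
    | zero => simp
    | add s t hs ht => simp only [map_add, add_tmul, tmul_add, hs, ht]
    | tmul u v => simp

theorem smashEval₇_comp_left (φ φ' φ'' : A) (a b d e : H)
    (t : (H ⊗[k] H) ⊗[k] ((H ⊗[k] H) ⊗[k] ((H ⊗[k] H) ⊗[k] H))) :
    smashEval₇ actL actR mulA (sandwich actL actR φ (a ⊗ₜ d)) (sandwich actL actR φ' (b ⊗ₜ e))
        φ'' t =
      smashEval₇ actL actR mulA φ φ' φ'' ((smashLeg₇ k H 4 d * smashLeg₇ k H 5 e) * t *
        (smashLeg₇ k H 0 a * smashLeg₇ k H 1 b)) := by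
  induction t using smash_induction₇ with
  | zero => simp
  | add s t hs ht => simp only [map_add, add_mul, mul_add, hs, ht]
  | tmul x x' y y' z z' c =>
    simp [-sandwich_tmul, hba.sandwich_comp]

theorem smashEval₇_comp_right (φ φ' φ'' : A) (a b d e : H)
    (t : (H ⊗[k] H) ⊗[k] ((H ⊗[k] H) ⊗[k] ((H ⊗[k] H) ⊗[k] H))) :
    smashEval₇ actL actR mulA φ (sandwich actL actR φ' (a ⊗ₜ d))
        (sandwich actL actR φ'' (b ⊗ₜ e)) t =
      smashEval₇ actL actR mulA φ φ' φ'' ((smashLeg₇ k H 5 d * smashLeg₇ k H 6 e) * t *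
        (smashLeg₇ k H 1 a * smashLeg₇ k H 2 b)) := by
  induction t using smash_induction₇ with
  | zero => simp
  | add s t hs ht => simp only [map_add, add_mul, mul_add, hs, ht]
  | tmul x x' y y' z z' c =>
    simp [-sandwich_tmul, hba.sandwich_comp]

theorem smashMul_smashEval₅_left (φ φ' φ'' : A) (t : (H ⊗[k] H) ⊗[k] ((H ⊗[k] H) ⊗[k] H))
    (h : H) :
    smashMul actL actR mulA Δ Φinv (smashEval₅ actL actR mulA φ φ' t) (φ'' ⊗ₜ h) =
      smashEval₇ actL actR mulA φ φ' φ''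
        (leg₃ (smashLeg₇ k H 0) (smashLeg₇ k H 1) (smashLeg₇ k H 2) Φ *
          leg₃ (coprodLeg Δ (smashLeg₇ k H 0) (smashLeg₇ k H 1)
            (smashLeg₇_imagesCommute (by decide))) (smashLeg₇ k H 2) (smashLeg₇ k H 3) Φinv *
          splitMidLeft Δ t *
          (leg₃ (smashLeg₇ k H 2) (smashLeg₇ k H 3) (coprodLeg Δ (smashLeg₇ k H 4)
              (smashLeg₇ k H 5) (smashLeg₇_imagesCommute (by decide))) Φinv *
            leg₂ (smashLeg₇ k H 3) (coprodLeg Δ (smashLeg₇ k H 4)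
              (smashLeg₇ k H 5) (smashLeg₇_imagesCommute (by decide))) (Δ h) *
            leg₃ (smashLeg₇ k H 3) (coprodLeg Δ (smashLeg₇ k H 4)
              (smashLeg₇ k H 5) (smashLeg₇_imagesCommute (by decide))) (smashLeg₇ k H 6) Φinv *
            leg₃ (smashLeg₇ k H 4) (smashLeg₇ k H 5) (smashLeg₇ k H 6) Φinv)) := by
  induction t using smash_induction₅ with
  | zero => simp
  | add s t hs ht => simp only [map_add, LinearMap.add_apply, mul_add, add_mul, hs, ht]
  | tmul a d b e c =>
    rw [smashEval₅_tmul, smashMul_tmul, hba.smashEval₅_mulA_left, hba.smashEval₇_comp_left,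
      splitMidLeft_tmul, smashKernel₅, map_smashKernel, splitFirst_comp_zero, splitFirst_comp_one,
      splitFirst_comp_two, splitFirst_comp_three, splitFirst_comp_four]
    exact congrArg _ (smashKernel_swap_left _ smashLeg₇_imagesCommute _ _ a b c d e h)

theorem smashMul_smashEval₅_right (φ φ' φ'' : A) (t : (H ⊗[k] H) ⊗[k] ((H ⊗[k] H) ⊗[k] H))
    (h : H) :
    smashMul actL actR mulA Δ Φinv (φ ⊗ₜ h) (smashEval₅ actL actR mulA φ' φ'' t) =
      smashEval₇ actL actR mulA φ φ' φ''
        (leg₃ (smashLeg₇ k H 0) (coprodLeg Δ (smashLeg₇ k H 1) (smashLeg₇ k H 2)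
            (smashLeg₇_imagesCommute (by decide))) (smashLeg₇ k H 3) Φinv *
          leg₂ (coprodLeg Δ (smashLeg₇ k H 1) (smashLeg₇ k H 2)
            (smashLeg₇_imagesCommute (by decide))) (smashLeg₇ k H 3) (Δ h) *
          leg₃ (coprodLeg Δ (smashLeg₇ k H 1) (smashLeg₇ k H 2)
            (smashLeg₇_imagesCommute (by decide))) (smashLeg₇ k H 3) (smashLeg₇ k H 4) Φinv *
          splitMidRight Δ t *
          leg₃ (smashLeg₇ k H 3) (smashLeg₇ k H 4) (coprodLeg Δ (smashLeg₇ k H 5)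
            (smashLeg₇ k H 6) (smashLeg₇_imagesCommute (by decide))) Φinv) := by
  induction t using smash_induction₅ with
  | zero => simp
  | add s t hs ht => simp only [map_add, mul_add, add_mul, hs, ht]
  | tmul a d b e c =>
    rw [smashEval₅_tmul, smashMul_tmul, hba.smashEval₅_mulA_right, hba.smashEval₇_comp_right,
      splitMidRight_tmul, smashKernel₅, map_smashKernel, splitSecond_comp_zero,
      splitSecond_comp_one, splitSecond_comp_two, splitSecond_comp_three, splitSecond_comp_four]
    exact congrArg _ (smashKernel_swap_right _ smashLeg₇_imagesCommute _ a b c d e h)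

theorem smashMul_assoc (hqb : IsQuasiBialgebra Δ ε Φ Φinv) (x y z : A ⊗[k] H) :
    smashMul actL actR mulA Δ Φinv (smashMul actL actR mulA Δ Φinv x y) z =
      smashMul actL actR mulA Δ Φinv x (smashMul actL actR mulA Δ Φinv y z) := by
  induction x using TensorProduct.induction_on with
  | zero => simp
  | add x y hx hy => simp only [map_add, LinearMap.add_apply, hx, hy]
  | tmul φ h =>
  induction y using TensorProduct.induction_on with
  | zero => simp
  | add x y hx hy => simp only [map_add, LinearMap.add_apply, hx, hy]
  | tmul φ' h' =>
  induction z using TensorProduct.induction_on with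
  | zero => simp
  | add x y hx hy => simp only [map_add, hx, hy]
  | tmul φ'' h'' =>
    rw [smashMul_tmul, smashMul_tmul, hba.smashMul_smashEval₅_left,
      hba.smashMul_smashEval₅_right, smashKernel₅, smashKernel₅, map_smashKernel,
      map_smashKernel, splitMidLeft_comp_zero, splitMidLeft_comp_one, splitMidLeft_comp_two,
      splitMidLeft_comp_three, splitMidLeft_comp_four, splitMidRight_comp_zero,
      splitMidRight_comp_one, splitMidRight_comp_two, splitMidRight_comp_three,
      splitMidRight_comp_four]
    exact congrArg _ (hqb.smashKernel_assoc (smashLeg₇ k H) smashLeg₇_imagesCommute h h' h'')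

theorem sandwich_one (t : H ⊗[k] H) :
    sandwich actL actR oneA t = counitPair ε t • oneA := by
  induction t using TensorProduct.induction_on with
  | zero => simp
  | tmul x y => simp [hba.actL_one, hba.one_actR, ← smul_tmul', mul_smul]
  | add s t hs ht => simp only [map_add, add_smul, hs, ht]

theorem smashEval₅_one_left (φ : A) (t : (H ⊗[k] H) ⊗[k] ((H ⊗[k] H) ⊗[k] H)) :
    smashEval₅ actL actR mulA oneA φ t =
      rTensor H (sandwich actL actR φ) (killFirst ε t) := by
  induction t using tensor_induction_right₃ with
  | zero => simp
  | tmul s t c => simp [hba.sandwich_one, hba.one_mulA, ← smul_tmul']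
  | add s t hs ht => simp only [map_add, hs, ht]

theorem smashEval₅_one_right (φ : A) (t : (H ⊗[k] H) ⊗[k] ((H ⊗[k] H) ⊗[k] H)) :
    smashEval₅ actL actR mulA φ oneA t =
      rTensor H (sandwich actL actR φ) (killSecond ε t) := by
  induction t using tensor_induction_right₃ with
  | zero => simp
  | tmul s t c => simp [hba.sandwich_one, hba.mulA_one, ← smul_tmul']
  | add s t hs ht => simp only [map_add, hs, ht]

theorem smashMul_one_left (hqb : IsQuasiBialgebra Δ ε Φ Φinv) (x : A ⊗[k] H) :
    smashMul actL actR mulA Δ Φinv (oneA ⊗ₜ 1) x = x := by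
  induction x using TensorProduct.induction_on with
  | zero => simp
  | add x y hx hy => simp only [map_add, hx, hy]
  | tmul φ h =>
    rw [smashMul_tmul, hba.smashEval₅_one_left, killFirst_smashKernel₅ ε hqb]
    simp [Algebra.TensorProduct.one_def, hba.one_actL, hba.actR_one]

theorem smashMul_one_right (hqb : IsQuasiBialgebra Δ ε Φ Φinv) (x : A ⊗[k] H) :
    smashMul actL actR mulA Δ Φinv x (oneA ⊗ₜ 1) = x := by
  induction x using TensorProduct.induction_on with
  | zero => simp
  | add x y hx hy => simp only [map_add, LinearMap.add_apply, hx, hy]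
  | tmul φ h =>
    rw [smashMul_tmul, hba.smashEval₅_one_right, killSecond_smashKernel₅ ε hqb]
    simp [Algebra.TensorProduct.one_def, hba.one_actL, hba.actR_one]

end IsBimoduleAlgebra

end SmashProduct

/-- Let `H` be a quasi-bialgebra and `A` an `H`-bimodule algebra. Then the
L-R-smash product `A ♮ H`, i.e. `A ⊗ H` with the (bilinear) multiplication determined by
`(φ⊗h)(φ'⊗h') = (x¹·φ·z³h'₂y²)(x²h₁z¹·φ'·y³) ⊗ x³h₂z²h'₁y¹` (with `x`, `y`, `z` copies
of `Φ⁻¹`), is an associative unital algebra with unit `1_A ⊗ 1_H`. -/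
theorem lr_smash_product_is_unital_associative_algebra
    {k : Type*} [Field k] {H : Type*} [Ring H] [Algebra k H]
    {A : Type*} [AddCommGroup A] [Module k A]
    (Δ : H →ₐ[k] H ⊗[k] H) (ε : H →ₐ[k] k) (Φ Φinv : (H ⊗[k] H) ⊗[k] H)
    (actL : H ⊗[k] A →ₗ[k] A) (actR : A ⊗[k] H →ₗ[k] A)
    (mulA : A ⊗[k] A →ₗ[k] A) (oneA : A)
    (hqb : IsQuasiBialgebra Δ ε Φ Φinv)
    (hba : IsBimoduleAlgebra actL actR mulA Δ ε Φ Φinv oneA) :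
    ∃ mul : A ⊗[k] H →ₗ[k] A ⊗[k] H →ₗ[k] A ⊗[k] H,
      (∀ (φ φ' : A) (h h' : H),
        mul (φ ⊗ₜ h) (φ' ⊗ₜ h') = smashRHS actL actR mulA Δ Φinv φ φ' h h') ∧
      (∀ x y z : A ⊗[k] H, mul (mul x y) z = mul x (mul y z)) ∧
      (∀ x : A ⊗[k] H, mul (oneA ⊗ₜ (1 : H)) x = x) ∧
      (∀ x : A ⊗[k] H, mul x (oneA ⊗ₜ (1 : H)) = x) := by
  refine ⟨smashMul actL actR mulA Δ Φinv, fun φ φ' h h' => ?_, hba.smashMul_assoc hqb,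
    hba.smashMul_one_left hqb, hba.smashMul_one_right hqb⟩
  rw [smashMul_tmul, smashRHS_eq, smashKernel₅]
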